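/- arXiv:1707.08723 — 14 statements merged into one kernel-verified Lean document; each statement's English description precedes it below -/
import Mathlib

section
/- Let X and Y be complete metric spaces equipped with dynamical systems π : ℝ × X → X and σ : ℝ × Y → Y, and let x₀ ∈ X, y₀ ∈ Y. Assume x₀ is uniformly comparable by character of recurrence with y₀, i.e. there exists a uniformly continuous map h : Σ_{y₀} → Σ_{x₀} with h(σ(t,y₀)) = π(t,x₀) for all t ∈ ℝ. Then x₀ is strongly comparable by character of recurrence with y₀: there exists a continuous map H : H(y₀) → H(x₀) such that H(y₀) = x₀ and H(σ(t,y)) = π(t, H(y)) for every y ∈ H(y₀) and every t ∈ ℝ. -/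
/-- Uniform comparability by character of recurrence implies strong
comparability (for complete phase spaces): if there is a uniformly continuous map
`f` of the trajectory `Σ_{y₀}` onto `Σ_{x₀}` with `f (σ t y₀) = π t x₀`, then there
is a continuous map `H` of the hull `H(y₀)` into the hull `H(x₀)` with `H y₀ = x₀`
and `H (σ t y) = π t (H y)` for all `y ∈ H(y₀)`, `t ∈ ℝ`. -/
theorem stmt_0 {X Y : Type*} [MetricSpace X] [CompleteSpace X]
    [MetricSpace Y] [CompleteSpace Y]
    (π : ℝ → X → X) (σ : ℝ → Y → Y)
    (hπc : Continuous fun p : ℝ × X => π p.1 p.2)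
    (hπ0 : ∀ x, π 0 x = x)
    (hπadd : ∀ t s : ℝ, ∀ x, π (t + s) x = π t (π s x))
    (hσc : Continuous fun p : ℝ × Y => σ p.1 p.2)
    (hσ0 : ∀ y, σ 0 y = y)
    (hσadd : ∀ t s : ℝ, ∀ y, σ (t + s) y = σ t (σ s y))
    (x₀ : X) (y₀ : Y) (f : Y → X)
    (hf_uc : UniformContinuousOn f (Set.range fun t => σ t y₀))
    (hf_maps : Set.MapsTo f (Set.range fun t => σ t y₀) (Set.range fun t => π t x₀))
    (hf_comm : ∀ t : ℝ, f (σ t y₀) = π t x₀) :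
    ∃ H : Y → X,
      ContinuousOn H (closure (Set.range fun t => σ t y₀)) ∧
      Set.MapsTo H (closure (Set.range fun t => σ t y₀))
        (closure (Set.range fun t => π t x₀)) ∧
      H y₀ = x₀ ∧
      ∀ y ∈ closure (Set.range fun t => σ t y₀), ∀ t : ℝ, H (σ t y) = π t (H y) := by
  set S : Set Y := Set.range fun t => σ t y₀ with hS
  have hlim : ∀ y ∈ closure S, ∃ x, Filter.Tendsto f (nhdsWithin y S) (nhds x) := by
    intro y hy
    have hne : (nhdsWithin y S).NeBot := mem_closure_iff_nhdsWithin_neBot.1 hy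
    have hc : Cauchy (nhdsWithin y S) := cauchy_nhds.mono' hne inf_le_left
    have hm : Cauchy (Filter.map f (nhdsWithin y S)) := by
      refine ⟨hne.map f, ?_⟩
      rw [Filter.prod_map_map_eq]
      refine Filter.Tendsto.mono_left hf_uc (le_inf hc.2 ?_)
      rw [← Filter.prod_principal_principal]
      exact Filter.prod_mono inf_le_right inf_le_right
    exact CompleteSpace.complete hm
  have hcont : ContinuousOn (extendFrom S f) (closure S) :=
    continuousOn_extendFrom subset_rfl hlim
  have hmem : ∀ t, σ t y₀ ∈ S := fun t => ⟨t, rfl⟩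
  have heq : ∀ t, extendFrom S f (σ t y₀) = π t x₀ := by
    intro t
    rw [← hf_comm t]
    exact extendFrom_eq (subset_closure (hmem t)) (hf_uc.continuousOn _ (hmem t))
  have hinv : ∀ t, Set.MapsTo (σ t) S S := by
    rintro t _ ⟨s, rfl⟩
    exact ⟨t + s, hσadd t s y₀⟩
  have hσt : ∀ t, Continuous (σ t) := fun t => hσc.comp (Continuous.prodMk_right t)
  have hπt : ∀ t, Continuous (π t) := fun t => hπc.comp (Continuous.prodMk_right t)
  refine ⟨extendFrom S f, hcont, ?_, ?_, ?_⟩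
  · refine Set.MapsTo.closure_of_continuousOn ?_ hcont
    rintro _ ⟨t, rfl⟩
    exact ⟨t, (heq t).symm⟩
  · have := heq 0
    rwa [hσ0, hπ0] at this
  · intro y hy t
    have hE : Set.EqOn (fun y => extendFrom S f (σ t y))
        (fun y => π t (extendFrom S f y)) S := by
      rintro _ ⟨s, rfl⟩
      simp only
      rw [← hσadd, heq, heq, hπadd]
    exact hE.of_subset_closure
      (hcont.comp (hσt t).continuousOn ((hinv t).closure (hσt t)))
      ((hπt t).comp_continuousOn hcont) subset_closure subset_rfl hy
end

section
/- Let X and Y be metric spaces equipped with dynamical systems π : ℝ × X → X and σ : ℝ × Y → Y, and let x₀ ∈ X, y₀ ∈ Y. Assume x₀ is uniformly comparable by character of recurrence with y₀, i.e. there exists a uniformly continuous map h : Σ_{y₀} → Σ_{x₀} with h(σ(t,y₀)) = π(t,x₀) for all t ∈ ℝ. If y₀ is pseudo recurrent, then x₀ is pseudo recurrent. -/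
/-- If `x₀` is uniformly comparable by character of recurrence with `y₀`
(via a uniformly continuous map `f : Σ_{y₀} → Σ_{x₀}` with `f (σ t y₀) = π t x₀`) and
`y₀` is pseudo recurrent, then `x₀` is pseudo recurrent. -/
theorem stmt_1 {X Y : Type*} [MetricSpace X] [MetricSpace Y]
    (π : ℝ → X → X) (σ : ℝ → Y → Y)
    (hπc : Continuous fun p : ℝ × X => π p.1 p.2)
    (hπ0 : ∀ x, π 0 x = x)
    (hπadd : ∀ t s : ℝ, ∀ x, π (t + s) x = π t (π s x))
    (hσc : Continuous fun p : ℝ × Y => σ p.1 p.2)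
    (hσ0 : ∀ y, σ 0 y = y)
    (hσadd : ∀ t s : ℝ, ∀ y, σ (t + s) y = σ t (σ s y))
    (x₀ : X) (y₀ : Y) (f : Y → X)
    (hf_uc : UniformContinuousOn f (Set.range fun t => σ t y₀))
    (hf_maps : Set.MapsTo f (Set.range fun t => σ t y₀) (Set.range fun t => π t x₀))
    (hf_comm : ∀ t : ℝ, f (σ t y₀) = π t x₀)
    -- `y₀` is pseudo recurrent
    (hy : ∀ ε > (0 : ℝ), ∀ t₀ : ℝ, ∃ L > (0 : ℝ),
      ∀ q ∈ (Set.range fun t => σ t y₀), ∃ τ ∈ Set.Icc t₀ (t₀ + L), dist (σ τ q) q < ε) :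
    -- then `x₀` is pseudo recurrent
    ∀ ε > (0 : ℝ), ∀ t₀ : ℝ, ∃ L > (0 : ℝ),
      ∀ p ∈ (Set.range fun t => π t x₀), ∃ τ ∈ Set.Icc t₀ (t₀ + L), dist (π τ p) p < ε := by
  intro ε hε t₀
  obtain ⟨δ, hδ, H⟩ := Metric.uniformContinuousOn_iff.1 hf_uc ε hε
  obtain ⟨L, hL, hq⟩ := hy δ hδ t₀
  refine ⟨L, hL, ?_⟩
  rintro _ ⟨t, rfl⟩
  obtain ⟨τ, hτ, hd⟩ := hq (σ t y₀) ⟨t, rfl⟩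
  refine ⟨τ, hτ, ?_⟩
  have key := H (σ (τ + t) y₀) ⟨τ + t, rfl⟩ (σ t y₀) ⟨t, rfl⟩ (by rw [hσadd]; exact hd)
  rw [hf_comm, hf_comm, hπadd] at key
  exact key
end

section
/- Let X and Y be metric spaces equipped with dynamical systems π : ℝ × X → X and σ : ℝ × Y → Y, and let x₀ ∈ X, y₀ ∈ Y. Assume x₀ is uniformly comparable by character of recurrence with y₀, i.e. there exists a uniformly continuous map h : Σ_{y₀} → Σ_{x₀} with h(σ(t,y₀)) = π(t,x₀) for all t ∈ ℝ. If y₀ is pseudo periodic, then x₀ is pseudo periodic. -/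
/-- If `x₀` is uniformly comparable by character of recurrence with `y₀`
(via a uniformly continuous map `f : Σ_{y₀} → Σ_{x₀}` with `f (σ t y₀) = π t x₀`) and
`y₀` is pseudo periodic (uniformly Poisson stable), then `x₀` is pseudo periodic. -/
theorem stmt_2 {X Y : Type*} [MetricSpace X] [MetricSpace Y]
    (π : ℝ → X → X) (σ : ℝ → Y → Y)
    (hπc : Continuous fun p : ℝ × X => π p.1 p.2)
    (hπ0 : ∀ x, π 0 x = x)
    (hπadd : ∀ t s : ℝ, ∀ x, π (t + s) x = π t (π s x))
    (hσc : Continuous fun p : ℝ × Y => σ p.1 p.2)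
    (hσ0 : ∀ y, σ 0 y = y)
    (hσadd : ∀ t s : ℝ, ∀ y, σ (t + s) y = σ t (σ s y))
    (x₀ : X) (y₀ : Y) (f : Y → X)
    (hf_uc : UniformContinuousOn f (Set.range fun t => σ t y₀))
    (hf_maps : Set.MapsTo f (Set.range fun t => σ t y₀) (Set.range fun t => π t x₀))
    (hf_comm : ∀ t : ℝ, f (σ t y₀) = π t x₀)
    -- `y₀` is pseudo periodic
    (hy : ∀ ε > (0 : ℝ), ∀ t₀ : ℝ, ∃ τ > t₀,
      ∀ q ∈ (Set.range fun t => σ t y₀), dist (σ τ q) q < ε) :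
    -- then `x₀` is pseudo periodic
    ∀ ε > (0 : ℝ), ∀ t₀ : ℝ, ∃ τ > t₀,
      ∀ p ∈ (Set.range fun t => π t x₀), dist (π τ p) p < ε := by
  intro ε hε t₀
  obtain ⟨δ, hδ, H⟩ := Metric.uniformContinuousOn_iff.1 hf_uc ε hε
  obtain ⟨τ, hτ, hq⟩ := hy δ hδ t₀
  refine ⟨τ, hτ, ?_⟩
  rintro _ ⟨t, rfl⟩
  have h1 := hq (σ t y₀) ⟨t, rfl⟩
  rw [← hσadd] at h1
  have h2 := H (σ (τ + t) y₀) ⟨τ + t, rfl⟩ (σ t y₀) ⟨t, rfl⟩ h1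
  rw [hf_comm, hf_comm, hπadd] at h2
  exact h2
end

section
/- Let ⟨(X,ℝ,π),(Y,ℝ,σ),h⟩ be a non-autonomous dynamical system, x₀ ∈ X, y₀ := h(x₀), and assume Σ_{x₀} is conditionally precompact relative to h. If H(x₀) ∩ X_{y₀} = {x₀}, then 𝔑_{y₀} ⊆ 𝔑_{x₀}: every sequence (t_n) ⊆ ℝ with σ(t_n, y₀) → y₀ satisfies π(t_n, x₀) → x₀. -/
open Filter Topology

/-- Let `⟨(X,ℝ,π),(Y,ℝ,σ),h⟩` be a non-autonomous dynamical system,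
`x₀ ∈ X`, `y₀ := h x₀`, with `Σ_{x₀}` conditionally precompact relative to `h`.
If `H(x₀) ∩ X_{y₀} = {x₀}` then `𝔑_{y₀} ⊆ 𝔑_{x₀}`. -/
theorem stmt_3 {X Y : Type*} [MetricSpace X] [MetricSpace Y]
    (π : ℝ → X → X) (σ : ℝ → Y → Y) (h : X → Y)
    (hπc : Continuous fun p : ℝ × X => π p.1 p.2)
    (hπ0 : ∀ x, π 0 x = x)
    (hπadd : ∀ t s : ℝ, ∀ x, π (t + s) x = π t (π s x))
    (hσc : Continuous fun p : ℝ × Y => σ p.1 p.2)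
    (hσ0 : ∀ y, σ 0 y = y)
    (hσadd : ∀ t s : ℝ, ∀ y, σ (t + s) y = σ t (σ s y))
    (hc : Continuous h)
    (hequiv : ∀ t : ℝ, ∀ x, h (π t x) = σ t (h x))
    (x₀ : X)
    -- `Σ_{x₀}` is conditionally precompact relative to `h`
    (hcp : ∀ K : Set Y, IsCompact K →
      IsCompact (closure ((Set.range fun t => π t x₀) ∩ h ⁻¹' K)))
    -- `H(x₀) ∩ X_{y₀}` consists of the single point `x₀`
    (hsingle : closure (Set.range fun t => π t x₀) ∩ h ⁻¹' {h x₀} = {x₀}) :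
    ∀ t : ℕ → ℝ,
      Tendsto (fun n => σ (t n) (h x₀)) atTop (𝓝 (h x₀)) →
      Tendsto (fun n => π (t n) x₀) atTop (𝓝 x₀) := by
  intro t ht
  have hK := ht.isCompact_insert_range
  have hmem : ∀ n, π (t n) x₀ ∈ closure ((Set.range fun t => π t x₀) ∩
      h ⁻¹' (insert (h x₀) (Set.range fun n => σ (t n) (h x₀)))) := by
    intro n
    apply subset_closure
    refine ⟨⟨t n, rfl⟩, Or.inr ⟨n, ?_⟩⟩
    exact (hequiv (t n) x₀).symm
  refine (hcp _ hK).tendsto_nhds_of_unique_mapClusterPt (Eventually.of_forall hmem) ?_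
  intro y hy hcl
  have h1 : y ∈ closure (Set.range fun t => π t x₀) :=
    closure_mono Set.inter_subset_left hy
  obtain ⟨φ, hφ, hlim⟩ := TopologicalSpace.FirstCountableTopology.tendsto_subseq hcl
  have h2 : Tendsto (fun n => h (π (t (φ n)) x₀)) atTop (𝓝 (h y)) :=
    (hc.tendsto y).comp hlim
  have h3 : Tendsto (fun n => h (π (t (φ n)) x₀)) atTop (𝓝 (h x₀)) := by
    simp only [hequiv]
    exact ht.comp hφ.tendsto_atTop
  have h4 : y ∈ closure (Set.range fun t => π t x₀) ∩ h ⁻¹' {h x₀} :=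
    ⟨h1, tendsto_nhds_unique h2 h3⟩
  rw [hsingle] at h4
  exact h4
end

section
/- Let ⟨(X,ℝ,π),(Y,ℝ,σ),h⟩ be a non-autonomous dynamical system, x₀ ∈ X, y₀ := h(x₀), and assume Σ_{x₀} is conditionally precompact relative to h. If for every q ∈ H(y₀) the set H(x₀) ∩ X_q contains at most one point, then 𝔐_{y₀} ⊆ 𝔐_{x₀}: whenever (σ(t_n, y₀))_n converges in Y, the sequence (π(t_n, x₀))_n converges in X. -/
open Filter Topology

/-- Let `⟨(X,ℝ,π),(Y,ℝ,σ),h⟩` be a non-autonomous dynamical system,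
`x₀ ∈ X`, `y₀ := h x₀`, with `Σ_{x₀}` conditionally precompact relative to `h`.
If `H(x₀) ∩ X_q` contains at most one point for every `q ∈ H(y₀)`,
then `𝔐_{y₀} ⊆ 𝔐_{x₀}`. -/
theorem stmt_4 {X Y : Type*} [MetricSpace X] [MetricSpace Y]
    (π : ℝ → X → X) (σ : ℝ → Y → Y) (h : X → Y)
    (hπc : Continuous fun p : ℝ × X => π p.1 p.2)
    (hπ0 : ∀ x, π 0 x = x)
    (hπadd : ∀ t s : ℝ, ∀ x, π (t + s) x = π t (π s x))
    (hσc : Continuous fun p : ℝ × Y => σ p.1 p.2)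
    (hσ0 : ∀ y, σ 0 y = y)
    (hσadd : ∀ t s : ℝ, ∀ y, σ (t + s) y = σ t (σ s y))
    (hc : Continuous h)
    (hequiv : ∀ t : ℝ, ∀ x, h (π t x) = σ t (h x))
    (x₀ : X)
    -- `Σ_{x₀}` is conditionally precompact relative to `h`
    (hcp : ∀ K : Set Y, IsCompact K →
      IsCompact (closure ((Set.range fun t => π t x₀) ∩ h ⁻¹' K)))
    -- `H(x₀) ∩ X_q` contains at most one point for every `q ∈ H(y₀)`
    (hsub : ∀ q ∈ closure (Set.range fun t => σ t (h x₀)),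
      (closure (Set.range fun t => π t x₀) ∩ h ⁻¹' {q}).Subsingleton) :
    ∀ t : ℕ → ℝ,
      (∃ q : Y, Tendsto (fun n => σ (t n) (h x₀)) atTop (𝓝 q)) →
      ∃ p : X, Tendsto (fun n => π (t n) x₀) atTop (𝓝 p) := by
  rintro t ⟨q, hq⟩
  have hK := hcp _ hq.isCompact_insert_range
  set C := closure ((Set.range fun t => π t x₀) ∩
    h ⁻¹' (insert q (Set.range fun n => σ (t n) (h x₀)))) with hC
  have hmem : ∀ n, π (t n) x₀ ∈ C := fun n =>
    subset_closure ⟨⟨t n, rfl⟩, Or.inr ⟨n, (hequiv _ _).symm⟩⟩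
  have hCsub : C ⊆ closure (Set.range fun t => π t x₀) :=
    closure_mono Set.inter_subset_left
  have hqm : q ∈ closure (Set.range fun t => σ t (h x₀)) :=
    mem_closure_of_tendsto hq (Eventually.of_forall fun n => ⟨t n, rfl⟩)
  have hcl : ∀ y, MapClusterPt y atTop (fun n => π (t n) x₀) → h y = q := by
    intro y hy
    have h1 : MapClusterPt (h y) atTop (h ∘ fun n => π (t n) x₀) :=
      hy.continuousAt_comp hc.continuousAt
    have h2 : (h ∘ fun n => π (t n) x₀) = fun n => σ (t n) (h x₀) := by
      funext n
      exact hequiv _ _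
    rw [h2] at h1
    have h3 : (𝓝 (h y) ⊓ 𝓝 q).NeBot := NeBot.mono h1 (inf_le_inf_left _ hq)
    exact eq_of_nhds_neBot h3
  obtain ⟨p, hp, hpc⟩ := hK.exists_mapClusterPt (f := atTop)
    (u := fun n => π (t n) x₀) (tendsto_principal.2 (Eventually.of_forall hmem))
  refine ⟨p, hK.tendsto_nhds_of_unique_mapClusterPt (Eventually.of_forall hmem) ?_⟩
  intro y hy hyc
  exact hsub q hqm ⟨hCsub hy, hcl y hyc⟩ ⟨hCsub hp, hcl p hpc⟩
end

section
/- Let ⟨(X,ℝ,π),(Y,ℝ,σ),h⟩ be a non-autonomous dynamical system and x₀ ∈ X with y₀ := h(x₀), and assume Σ_{x₀} is conditionally precompact relative to h. Suppose: (a) the dynamical system (Y,ℝ,σ) is minimal; (b) H(x₀) ∩ X_{y₀} = {x₀}; (c) H(x₀) is fibrewise distal, i.e. inf_{t∈ℝ} ρ(π(t,x₁), π(t,x₂)) > 0 for all x₁, x₂ ∈ H(x₀) with x₁ ≠ x₂ and h(x₁) = h(x₂). Then 𝔐_{y₀} ⊆ 𝔐_{x₀}: whenever (σ(t_n, y₀))_n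 converges in Y, the sequence (π(t_n, x₀))_n converges in X. -/
open Filter Topology

/-- Let `⟨(X,ℝ,π),(Y,ℝ,σ),h⟩` be a non-autonomous dynamical system,
`x₀ ∈ X`, `y₀ := h x₀`, with `Σ_{x₀}` conditionally precompact relative to `h`.
Assume (a) `(Y,ℝ,σ)` is minimal; (b) `H(x₀) ∩ X_{y₀} = {x₀}`; (c) `H(x₀)` is
fibrewise distal. Then `𝔐_{y₀} ⊆ 𝔐_{x₀}`. -/
theorem stmt_5 {X Y : Type*} [MetricSpace X] [MetricSpace Y]
    (π : ℝ → X → X) (σ : ℝ → Y → Y) (h : X → Y)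
    (hπc : Continuous fun p : ℝ × X => π p.1 p.2)
    (hπ0 : ∀ x, π 0 x = x)
    (hπadd : ∀ t s : ℝ, ∀ x, π (t + s) x = π t (π s x))
    (hσc : Continuous fun p : ℝ × Y => σ p.1 p.2)
    (hσ0 : ∀ y, σ 0 y = y)
    (hσadd : ∀ t s : ℝ, ∀ y, σ (t + s) y = σ t (σ s y))
    (hc : Continuous h)
    (hequiv : ∀ t : ℝ, ∀ x, h (π t x) = σ t (h x))
    (x₀ : X)
    -- `Σ_{x₀}` is conditionally precompact relative to `h`
    (hcp : ∀ K : Set Y, IsCompact K →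
      IsCompact (closure ((Set.range fun t => π t x₀) ∩ h ⁻¹' K)))
    -- (a) the dynamical system `(Y,ℝ,σ)` is minimal
    (hmin : ∀ q : Y, closure (Set.range fun t => σ t q) = Set.univ)
    -- (b) `H(x₀) ∩ X_{y₀}` consists of the single point `x₀`
    (hsingle : closure (Set.range fun t => π t x₀) ∩ h ⁻¹' {h x₀} = {x₀})
    -- (c) `H(x₀)` is fibrewise distal
    (hdistal : ∀ x₁ ∈ closure (Set.range fun t => π t x₀),
      ∀ x₂ ∈ closure (Set.range fun t => π t x₀),
      x₁ ≠ x₂ → h x₁ = h x₂ → 0 < ⨅ t : ℝ, dist (π t x₁) (π t x₂)) :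
    ∀ t : ℕ → ℝ,
      (∃ q : Y, Tendsto (fun n => σ (t n) (h x₀)) atTop (𝓝 q)) →
      ∃ p : X, Tendsto (fun n => π (t n) x₀) atTop (𝓝 p) := by
  set H := closure (Set.range fun t => π t x₀) with hH
  have hπt : ∀ t, Continuous (π t) := fun t =>
    hπc.comp (Continuous.prodMk continuous_const continuous_id)
  -- sequences in the hull with convergent projection have convergent subsequences
  have A : ∀ (u : ℕ → X) (y : Y), (∀ n, u n ∈ H) → Tendsto (fun n => h (u n)) atTop (𝓝 y) →
      ∃ p ∈ H, h p = y ∧ ∃ φ : ℕ → ℕ, StrictMono φ ∧ Tendsto (u ∘ φ) atTop (𝓝 p) := by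
    intro u y hu hy
    have h1 : ∀ n : ℕ, ∃ v ∈ Set.range fun t => π t x₀,
        dist (u n) v < 1 / ((n : ℝ) + 1) ∧ dist (h (u n)) (h v) < 1 / ((n : ℝ) + 1) := by
      intro n
      have hpos : (0 : ℝ) < 1 / ((n : ℝ) + 1) := Nat.one_div_pos_of_nat
      have hn : {v | dist (u n) v < 1 / ((n : ℝ) + 1) ∧
          dist (h (u n)) (h v) < 1 / ((n : ℝ) + 1)} ∈ 𝓝 (u n) := by
        apply IsOpen.mem_nhds
        · have o1 : IsOpen {v | dist (u n) v < 1 / ((n : ℝ) + 1)} :=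
            isOpen_lt (continuous_const.dist continuous_id) continuous_const
          have o2 : IsOpen {v | dist (h (u n)) (h v) < 1 / ((n : ℝ) + 1)} :=
            isOpen_lt (continuous_const.dist hc) continuous_const
          exact o1.inter o2
        · simp only [Set.mem_ofPred_eq, dist_self]
          exact ⟨hpos, hpos⟩
      obtain ⟨v, hv1, hv2⟩ := mem_closure_iff_nhds.1 (hu n) _ hn
      exact ⟨v, hv2, hv1⟩
    choose v hv hd hd' using h1
    have hlim := tendsto_one_div_add_atTop_nhds_zero_nat (𝕜 := ℝ)
    have hdu : Tendsto (fun n => dist (u n) (v n)) atTop (𝓝 0) :=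
      squeeze_zero (fun _ => dist_nonneg) (fun n => (hd n).le) hlim
    have hdh : Tendsto (fun n => dist (h (u n)) (h (v n))) atTop (𝓝 0) :=
      squeeze_zero (fun _ => dist_nonneg) (fun n => (hd' n).le) hlim
    have hvy : Tendsto (fun n => h (v n)) atTop (𝓝 y) :=
      (tendsto_iff_of_dist hdh).1 hy
    obtain ⟨p, -, φ, hφ, hp⟩ := (hcp _ hvy.isCompact_insert_range).tendsto_subseq
      (x := v) (fun n => subset_closure ⟨hv n, Or.inr ⟨n, rfl⟩⟩)
    have hup : Tendsto (u ∘ φ) atTop (𝓝 p) :=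
      (tendsto_iff_of_dist (hdu.comp hφ.tendsto_atTop)).2 hp
    refine ⟨p, isClosed_closure.mem_of_tendsto hup (Eventually.of_forall fun n => hu _), ?_,
      φ, hφ, hup⟩
    exact tendsto_nhds_unique ((hc.tendsto p).comp hup) (hy.comp hφ.tendsto_atTop)
  have B : ∀ u : ℕ → X, (∀ n, u n ∈ H) → Tendsto (fun n => h (u n)) atTop (𝓝 (h x₀)) →
      Tendsto u atTop (𝓝 x₀) := by
    intro u hu hy
    refine tendsto_of_subseq_tendsto fun ns hns => ?_
    obtain ⟨p, hpH, hpy, φ, -, hp⟩ := A (u ∘ ns) (h x₀) (fun n => hu _) (hy.comp hns)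
    have : p ∈ ({x₀} : Set X) := hsingle ▸ ⟨hpH, hpy⟩
    rw [Set.mem_singleton_iff] at this
    subst this
    exact ⟨φ, hp⟩
  -- invariance of the hull
  have hinv : ∀ s, ∀ p ∈ H, π s p ∈ H := by
    intro s p hp
    refine map_mem_closure (hπt s) hp ?_
    rintro _ ⟨t, rfl⟩
    exact ⟨s + t, hπadd s t x₀⟩
  have C : ∀ p₁ ∈ H, ∀ p₂ ∈ H, h p₁ = h p₂ → p₁ = p₂ := by
    intro p₁ h₁ p₂ h₂ he
    by_contra hne
    have hpos := hdistal p₁ h₁ p₂ h₂ hne he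
    have hy : h x₀ ∈ closure (Set.range fun t => σ t (h p₁)) := by
      rw [hmin]; trivial
    obtain ⟨w, hw, hwl⟩ := mem_closure_iff_seq_limit.1 hy
    choose s hs using hw
    have l1 : Tendsto (fun n => π (s n) p₁) atTop (𝓝 x₀) := by
      refine B _ (fun n => hinv _ _ h₁) ?_
      simp only [hequiv]
      exact hwl.congr fun n => (hs n).symm
    have l2 : Tendsto (fun n => π (s n) p₂) atTop (𝓝 x₀) := by
      refine B _ (fun n => hinv _ _ h₂) ?_
      simp only [hequiv, ← he]
      exact hwl.congr fun n => (hs n).symm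
    have l := l1.dist l2
    rw [dist_self] at l
    refine absurd hpos (not_lt.2 (ge_of_tendsto' l fun n => ?_))
    exact ciInf_le ⟨0, by rintro _ ⟨t, rfl⟩; exact dist_nonneg⟩ (s n)
  rintro t ⟨q, hq⟩
  have hu : ∀ n, π (t n) x₀ ∈ H := fun n => subset_closure ⟨t n, rfl⟩
  have hq' : Tendsto (fun n => h (π (t n) x₀)) atTop (𝓝 q) := by
    simpa only [hequiv] using hq
  obtain ⟨p, hpH, hpq, -⟩ := A _ q hu hq'
  refine ⟨p, tendsto_of_subseq_tendsto fun ns hns => ?_⟩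
  obtain ⟨p', hpH', hpq', φ, -, hp'⟩ := A (fun n => π (t (ns n)) x₀) q (fun n => hu _)
    (hq'.comp hns)
  obtain rfl := C p hpH p' hpH' (hpq.trans hpq'.symm)
  exact ⟨φ, hp'⟩
end

section
/- Let ⟨(X,ℝ₊,π),(Y,ℝ₊,σ),h⟩ be a non-autonomous dynamical system in which the two time sets coincide. Suppose that (Y,ℝ₊,σ) is minimal, i.e. closure{σ(t,y) : t ≥ 0} = Y for every y ∈ Y, and that M ⊆ X is a minimal set of the non-autonomous dynamical system which is conditionally compact relative to h. Then H(x) = M for every x ∈ M, where H(x) := closure{π(t,x) : t ≥ 0}. -/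
/-- (Lemma on minimal sets, part 2.) For a non-autonomous dynamical
system `⟨(X,ℝ₊,π),(Y,ℝ₊,σ),h⟩` whose base `(Y,ℝ₊,σ)` is minimal: if `M` is a
conditionally compact minimal set of the non-autonomous system, then `H(x) = M`
for every `x ∈ M`. -/
theorem stmt_7 {X Y : Type*} [MetricSpace X] [MetricSpace Y]
    (π : ℝ → X → X) (σ : ℝ → Y → Y) (h : X → Y)
    (hπc : Continuous fun p : ℝ × X => π p.1 p.2)
    (hπ0 : ∀ x, π 0 x = x)
    (hπadd : ∀ t s : ℝ, 0 ≤ t → 0 ≤ s → ∀ x, π (t + s) x = π t (π s x))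
    (hσc : Continuous fun p : ℝ × Y => σ p.1 p.2)
    (hσ0 : ∀ y, σ 0 y = y)
    (hσadd : ∀ t s : ℝ, 0 ≤ t → 0 ≤ s → ∀ y, σ (t + s) y = σ t (σ s y))
    (hc : Continuous h)
    (hequiv : ∀ t : ℝ, 0 ≤ t → ∀ x, h (π t x) = σ t (h x))
    -- `(Y,ℝ₊,σ)` is minimal
    (hYmin : ∀ y : Y, closure ((fun t => σ t y) '' Set.Ici (0 : ℝ)) = Set.univ)
    (M : Set X) (hMne : M.Nonempty) (hMcl : IsClosed M)
    (hMinv : ∀ t : ℝ, 0 ≤ t → ∀ x ∈ M, π t x ∈ M)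
    (hMY : h '' M = Set.univ)
    -- `M` is conditionally compact relative to `h`
    (hMcc : ∀ K : Set Y, IsCompact K → IsCompact (M ∩ h ⁻¹' K))
    -- `M` is a minimal set of the non-autonomous dynamical system
    (hMmin : ∀ M' ⊆ M, M'.Nonempty → IsClosed M' →
      (∀ t : ℝ, 0 ≤ t → ∀ x ∈ M', π t x ∈ M') → h '' M' = Set.univ → M' = M) :
    ∀ x ∈ M, closure ((fun t => π t x) '' Set.Ici (0 : ℝ)) = M := by
  intro x hx
  have hsub : ((fun t => π t x) '' Set.Ici (0 : ℝ)) ⊆ M := by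
    rintro _ ⟨t, ht, rfl⟩
    exact hMinv t ht x hx
  refine hMmin _ (closure_minimal hsub hMcl) ?_ isClosed_closure ?_ ?_
  · exact ⟨π 0 x, subset_closure ⟨0, Set.self_mem_Ici, rfl⟩⟩
  · intro t ht z hz
    have hcont : Continuous (fun z => π t z) :=
      hπc.comp (Continuous.prodMk continuous_const continuous_id)
    refine map_mem_closure hcont hz ?_
    rintro _ ⟨s, hs, rfl⟩
    exact ⟨t + s, add_nonneg ht hs, hπadd t s ht hs x⟩
  · refine Set.eq_univ_of_forall fun y => ?_
    have hy : y ∈ closure ((fun t => σ t (h x)) '' Set.Ici (0 : ℝ)) := by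
      rw [hYmin]; trivial
    obtain ⟨u, hu, hlim⟩ := mem_closure_iff_seq_limit.1 hy
    choose t ht htu using hu
    have hK := hMcc _ hlim.isCompact_insert_range
    have hhu : ∀ n, h (π (t n) x) = u n := fun n => (hequiv _ (ht n) x).trans (htu n)
    obtain ⟨p, -, φ, hφ, hp⟩ := hK.tendsto_subseq (x := fun n => π (t n) x) (fun n =>
      ⟨hMinv _ (ht n) x hx, by
        rw [Set.mem_preimage, hhu]
        exact Set.mem_insert_of_mem _ ⟨n, rfl⟩⟩)
    refine ⟨p, mem_closure_of_tendsto hp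
      (Filter.Eventually.of_forall fun n => ⟨t (φ n), ht _, rfl⟩), ?_⟩
    have h1 := (hc.tendsto p).comp hp
    have h2 := hlim.comp hφ.tendsto_atTop
    refine tendsto_nhds_unique h1 (h2.congr fun n => ?_)
    exact (hhu (φ n)).symm
end

section
/- Let ⟨(X,ℝ,π),(Y,ℝ,σ),h⟩ be a non-autonomous dynamical system with both time sets equal to ℝ, and let M ⊆ X be a nonempty, closed, positively invariant (π(t,M) ⊆ M for all t ≥ 0), conditionally compact set with h(M) = Y. If the dynamical system (Y,ℝ,σ) is minimal, then M is a minimal set of the non-autonomous dynamical system if and only if H(x) = M for every x ∈ M, where H(x) := closure{π(t,x) : t ∈ ℝ}. -/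
/-- (Corollary.) For a non-autonomous dynamical system
`⟨(X,ℝ,π),(Y,ℝ,σ),h⟩` with minimal base `(Y,ℝ,σ)` and a nonempty, closed,
positively invariant, conditionally compact set `M` with `h(M) = Y`:
`M` is a minimal set of the non-autonomous system iff `H(x) = M` for all `x ∈ M`. -/
theorem stmt_8 {X Y : Type*} [MetricSpace X] [MetricSpace Y]
    (π : ℝ → X → X) (σ : ℝ → Y → Y) (h : X → Y)
    (hπc : Continuous fun p : ℝ × X => π p.1 p.2)
    (hπ0 : ∀ x, π 0 x = x)
    (hπadd : ∀ t s : ℝ, ∀ x, π (t + s) x = π t (π s x))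
    (hσc : Continuous fun p : ℝ × Y => σ p.1 p.2)
    (hσ0 : ∀ y, σ 0 y = y)
    (hσadd : ∀ t s : ℝ, ∀ y, σ (t + s) y = σ t (σ s y))
    (hc : Continuous h)
    (hequiv : ∀ t : ℝ, ∀ x, h (π t x) = σ t (h x))
    -- `(Y,ℝ,σ)` is minimal
    (hYmin : ∀ q : Y, closure (Set.range fun t => σ t q) = Set.univ)
    (M : Set X) (hMne : M.Nonempty) (hMcl : IsClosed M)
    (hMinv : ∀ t : ℝ, 0 ≤ t → ∀ x ∈ M, π t x ∈ M)
    (hMY : h '' M = Set.univ)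
    -- `M` is conditionally compact relative to `h`
    (hMcc : ∀ K : Set Y, IsCompact K → IsCompact (M ∩ h ⁻¹' K)) :
    (∀ M' ⊆ M, M'.Nonempty → IsClosed M' →
        (∀ t : ℝ, 0 ≤ t → ∀ x ∈ M', π t x ∈ M') → h '' M' = Set.univ → M' = M) ↔
      (∀ x ∈ M, closure (Set.range fun t => π t x) = M) := by
  have hct : ∀ t, Continuous (π t) := fun t =>
    hπc.comp (Continuous.prodMk continuous_const continuous_id)
  have hcx : ∀ t s x, π t (π s x) = π (t + s) x := fun t s x => (hπadd t s x).symm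
  constructor
  · intro hmin x hx
    -- `M` is invariant for negative times too
    have hneg : ∀ s : ℝ, 0 ≤ s → ∀ z ∈ M, π (-s) z ∈ M := by
      intro s hs z hz
      have hsub : (π (-s)) ⁻¹' M ⊆ M := by
        intro w hw
        have := hMinv s hs _ hw
        rwa [hcx, add_neg_cancel, hπ0] at this
      have himg : ∀ w ∈ M, π s w ∈ (π (-s)) ⁻¹' M := by
        intro w hw
        rw [Set.mem_preimage, hcx, neg_add_cancel, hπ0]
        exact hw
      have heq := hmin ((π (-s)) ⁻¹' M) hsub
        (by obtain ⟨w, hw⟩ := hMne; exact ⟨_, himg w hw⟩)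
        (hMcl.preimage (hct _))
        (by
          intro t ht w hw
          have := hMinv t ht _ hw
          rw [Set.mem_preimage, hcx, add_comm, ← hcx]
          exact this)
        (by
          apply Set.eq_univ_of_forall
          intro y
          have hy : σ (-s) y ∈ h '' M := by rw [hMY]; trivial
          obtain ⟨w, hw, hwy⟩ := hy
          refine ⟨π s w, himg w hw, ?_⟩
          rw [hequiv, hwy, ← hσadd, add_neg_cancel, hσ0])
      rw [← heq] at hz
      exact hz
    have hinv : ∀ t : ℝ, ∀ z ∈ M, π t z ∈ M := by
      intro t z hz
      rcases le_total 0 t with ht | ht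
      · exact hMinv t ht z hz
      · have := hneg (-t) (by linarith) z hz
        rwa [neg_neg] at this
    apply hmin
    · apply closure_minimal _ hMcl
      rintro _ ⟨t, rfl⟩
      exact hinv t x hx
    · exact ⟨π 0 x, subset_closure ⟨0, rfl⟩⟩
    · exact isClosed_closure
    · intro t _ z hz
      refine map_mem_closure (hct t) hz ?_
      rintro _ ⟨s, rfl⟩
      exact ⟨t + s, hπadd t s x⟩
    · apply Set.eq_univ_of_forall
      intro y
      have hy : y ∈ closure (Set.range fun t => σ t (h x)) := by rw [hYmin]; trivial
      obtain ⟨u, hu, hlim⟩ := mem_closure_iff_seq_limit.1 hy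
      choose τ hτ using hu
      have hK := hMcc _ hlim.isCompact_insert_range
      obtain ⟨z, _, φ, hφ, hz⟩ := hK.tendsto_subseq (x := fun n => π (τ n) x) (by
        intro n
        refine ⟨hinv _ x hx, Or.inr ⟨n, ?_⟩⟩
        rw [hequiv]
        exact (hτ n).symm)
      refine ⟨z, mem_closure_of_tendsto hz (Filter.Eventually.of_forall fun n => ⟨_, rfl⟩), ?_⟩
      have h1 := (hc.tendsto z).comp hz
      have h2 := hlim.comp hφ.tendsto_atTop
      refine tendsto_nhds_unique h1 (h2.congr ?_)
      intro n
      simp only [Function.comp]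
      rw [hequiv]
      exact (hτ _).symm
  · intro hH M' hsub _ hcl hinv hY
    obtain ⟨x₀, _⟩ := hMne
    let A : ℕ → Set X := fun n => (π (-(n : ℝ))) ⁻¹' M' ∩ (M ∩ h ⁻¹' {h x₀})
    have hAcl : ∀ n, IsClosed (A n) := fun n =>
      (hcl.preimage (hct _)).inter (hMcl.inter (isClosed_singleton.preimage hc))
    have hne : (⋂ n, A n).Nonempty := by
      apply IsCompact.nonempty_iInter_of_sequence_nonempty_isCompact_isClosed
      · rintro n w ⟨hw, hw'⟩
        refine ⟨?_, hw'⟩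
        have := hinv 1 zero_le_one _ hw
        rw [hcx] at this
        rw [Set.mem_preimage]
        convert this using 2
        push_cast
        ring
      · intro n
        have hy : σ (-(n : ℝ)) (h x₀) ∈ h '' M' := by rw [hY]; trivial
        obtain ⟨w, hw, hwy⟩ := hy
        refine ⟨π n w, ?_, hMinv n n.cast_nonneg w (hsub hw), ?_⟩
        · rw [Set.mem_preimage, hcx, neg_add_cancel, hπ0]
          exact hw
        · rw [Set.mem_preimage, hequiv, hwy, ← hσadd, add_neg_cancel, hσ0]
          rfl
      · exact (hMcc _ isCompact_singleton).of_isClosed_subset (hAcl 0) Set.inter_subset_right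
      · exact hAcl
    obtain ⟨x, hx⟩ := hne
    rw [Set.mem_iInter] at hx
    apply hsub.antisymm
    rw [← hH x (hx 0).2.1]
    apply closure_minimal _ hcl
    rintro _ ⟨t, rfl⟩
    obtain ⟨n, hn⟩ := exists_nat_ge (-t)
    have := hinv (t + n) (by linarith) _ (hx n).1
    rw [hcx, add_neg_cancel_right] at this
    exact this
end

section
/- Let ⟨(X,ℝ₊,π),(Y,ℝ,σ),h⟩ be a non-autonomous dynamical system with h surjective, and suppose X is conditionally compact relative to h, i.e. h⁻¹(K) is compact for every compact K ⊆ Y. Then there exists a minimal set of the non-autonomous dynamical system: a nonempty, closed, positively invariant set M ⊆ X with h(M) = Y which contains no proper nonempty closed positively invariant subset M' with h(M') = Y. -/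
/-- (Birkhoff's theorem for non-autonomous dynamical systems.)
If `⟨(X,ℝ₊,π),(Y,ℝ,σ),h⟩` is a non-autonomous dynamical system with `h` surjective
and `X` conditionally compact relative to `h`, then there exists a minimal set of
the non-autonomous dynamical system. -/
theorem stmt_9 {X Y : Type*} [MetricSpace X] [MetricSpace Y] [Nonempty Y]
    (π : ℝ → X → X) (σ : ℝ → Y → Y) (h : X → Y)
    (hπc : Continuous fun p : ℝ × X => π p.1 p.2)
    (hπ0 : ∀ x, π 0 x = x)
    (hπadd : ∀ t s : ℝ, 0 ≤ t → 0 ≤ s → ∀ x, π (t + s) x = π t (π s x))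
    (hσc : Continuous fun p : ℝ × Y => σ p.1 p.2)
    (hσ0 : ∀ y, σ 0 y = y)
    (hσadd : ∀ t s : ℝ, ∀ y, σ (t + s) y = σ t (σ s y))
    (hc : Continuous h)
    (hequiv : ∀ t : ℝ, 0 ≤ t → ∀ x, h (π t x) = σ t (h x))
    (hsurj : Function.Surjective h)
    -- `X` is conditionally compact relative to `h`
    (hcc : ∀ K : Set Y, IsCompact K → IsCompact (h ⁻¹' K)) :
    ∃ M : Set X, M.Nonempty ∧ IsClosed M ∧
      (∀ t : ℝ, 0 ≤ t → ∀ x ∈ M, π t x ∈ M) ∧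
      h '' M = Set.univ ∧
      ∀ M' ⊆ M, M'.Nonempty → IsClosed M' →
        (∀ t : ℝ, 0 ≤ t → ∀ x ∈ M', π t x ∈ M') → h '' M' = Set.univ → M' = M := by
  obtain ⟨M, hM⟩ := zorn_superset
    {M : Set X | IsClosed M ∧ (∀ t : ℝ, 0 ≤ t → ∀ x ∈ M, π t x ∈ M) ∧ h '' M = Set.univ} (by
      intro c hcS hchain
      rcases c.eq_empty_or_nonempty with rfl | hne
      · exact ⟨Set.univ, ⟨isClosed_univ, fun _ _ _ _ => Set.mem_univ _, by
          rw [Set.image_univ, hsurj.range_eq]⟩, by simp⟩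
      · refine ⟨⋂₀ c, ⟨isClosed_sInter fun s hs => (hcS hs).1, ?_, ?_⟩,
          fun s hs => Set.sInter_subset_of_mem hs⟩
        · intro t ht x hx s hs
          exact (hcS hs).2.1 t ht x (hx s hs)
        · rw [Set.eq_univ_iff_forall]
          intro y
          have hK : IsCompact (h ⁻¹' {y}) := hcc _ isCompact_singleton
          have : Nonempty c := hne.to_subtype
          have key : (⋂ s : c, (s : Set X) ∩ h ⁻¹' {y}).Nonempty := by
            apply IsCompact.nonempty_iInter_of_directed_nonempty_isCompact_isClosed
            · intro a b
              rcases hchain.total a.2 b.2 with hab | hab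
              · exact ⟨a, subset_rfl, Set.inter_subset_inter_left _ hab⟩
              · exact ⟨b, Set.inter_subset_inter_left _ hab, subset_rfl⟩
            · intro s
              have hy : y ∈ h '' (s : Set X) := by
                rw [(hcS s.2).2.2]; exact Set.mem_univ y
              obtain ⟨x, hx, hxy⟩ := hy
              exact ⟨x, hx, hxy⟩
            · intro s
              exact hK.inter_left (hcS s.2).1
            · intro s
              exact (hcS s.2).1.inter hK.isClosed
          obtain ⟨x, hx⟩ := key
          rw [Set.mem_iInter] at hx
          obtain ⟨s, hs⟩ := hne
          exact ⟨x, fun u hu => (hx ⟨u, hu⟩).1, (hx ⟨s, hs⟩).2⟩)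
  obtain ⟨⟨h1, h2, h3⟩, hmin⟩ := hM
  refine ⟨M, ?_, h1, h2, h3, ?_⟩
  · rw [← Set.image_nonempty (f := h), h3]
    exact Set.univ_nonempty
  · intro M' hsub _ h1' h2' h3'
    exact Set.Subset.antisymm hsub (hmin ⟨h1', h2', h3'⟩ hsub)
end

section
/- Let ⟨(X,ℝ₊,π),(Y,ℝ,σ),h⟩ be a non-autonomous dynamical system and x₀ ∈ X such that the positive semi-trajectory Σ⁺_{x₀} := {π(t,x₀) : t ≥ 0} is conditionally precompact relative to h. Then for every point x of the ω-limit set ω_{x₀} := ⋂_{t≥0} closure(⋃_{τ≥t} {π(τ,x₀)}) there exists an entire trajectory γ : ℝ → X of the semigroup dynamical system (X,ℝ₊,π) with γ(0) = x and γ(t) ∈ ω_{x₀} for every t ∈ ℝ. -/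
open Filter Topology

/-- For a non-autonomous dynamical system `⟨(X,ℝ₊,π),(Y,ℝ,σ),h⟩`
with `Σ⁺_{x₀}` conditionally precompact relative to `h`, through every point `x` of the
ω-limit set `ω_{x₀}` there passes an entire trajectory `γ` of `(X,ℝ₊,π)` with
`γ(ℝ) ⊆ ω_{x₀}`. -/
theorem stmt_10 {X Y : Type*} [MetricSpace X] [MetricSpace Y]
    (π : ℝ → X → X) (σ : ℝ → Y → Y) (h : X → Y)
    (hπc : Continuous fun p : ℝ × X => π p.1 p.2)
    (hπ0 : ∀ x, π 0 x = x)
    (hπadd : ∀ t s : ℝ, 0 ≤ t → 0 ≤ s → ∀ x, π (t + s) x = π t (π s x))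
    (hσc : Continuous fun p : ℝ × Y => σ p.1 p.2)
    (hσ0 : ∀ y, σ 0 y = y)
    (hσadd : ∀ t s : ℝ, ∀ y, σ (t + s) y = σ t (σ s y))
    (hc : Continuous h)
    (hequiv : ∀ t : ℝ, 0 ≤ t → ∀ x, h (π t x) = σ t (h x))
    (x₀ : X)
    -- `Σ⁺_{x₀}` is conditionally precompact relative to `h`
    (hcp : ∀ K : Set Y, IsCompact K →
      IsCompact (closure (((fun t => π t x₀) '' Set.Ici (0 : ℝ)) ∩ h ⁻¹' K))) :
    ∀ x ∈ ⋂ t ∈ Set.Ici (0 : ℝ), closure ((fun τ => π τ x₀) '' Set.Ici t),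
      ∃ γ : ℝ → X, Continuous γ ∧ γ 0 = x ∧
        (∀ t : ℝ, 0 ≤ t → ∀ s : ℝ, π t (γ s) = γ (t + s)) ∧
        ∀ s : ℝ, γ s ∈ ⋂ t ∈ Set.Ici (0 : ℝ), closure ((fun τ => π τ x₀) '' Set.Ici t) := by
  set Ω : Set X := ⋂ t ∈ Set.Ici (0 : ℝ), closure ((fun τ => π τ x₀) '' Set.Ici t) with hΩ
  have memΩ : ∀ x, x ∈ Ω ↔ ∀ t : ℝ, 0 ≤ t → x ∈ closure ((fun τ => π τ x₀) '' Set.Ici t) := by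
    intro x
    simp only [hΩ, Set.mem_iInter, Set.mem_Ici]
  have hπt : ∀ t : ℝ, Continuous (π t) := fun t =>
    hπc.comp (continuous_const.prodMk continuous_id)
  -- positive invariance
  have hinv : ∀ t : ℝ, 0 ≤ t → ∀ x ∈ Ω, π t x ∈ Ω := by
    intro t ht x hx
    rw [memΩ] at hx ⊢
    intro r hr
    refine map_mem_closure (hπt t) (hx r hr) ?_
    rintro _ ⟨τ, hτ, rfl⟩
    have hτ' : r ≤ τ := hτ
    refine ⟨t + τ, ?_, hπadd t τ ht (hr.trans hτ') x₀⟩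
    show r ≤ t + τ
    linarith
  -- backward step
  have hback : ∀ x ∈ Ω, ∃ y ∈ Ω, π 1 y = x := by
    intro x hx
    rw [memΩ] at hx
    have hseq : ∀ n : ℕ, ∃ t : ℝ, (n : ℝ) + 1 ≤ t ∧ dist x (π t x₀) < 1 / ((n : ℝ) + 1) := by
      intro n
      obtain ⟨_, ⟨t, ht, rfl⟩, hd⟩ := Metric.mem_closure_iff.1 (hx (n + 1) (by positivity))
        (1 / ((n : ℝ) + 1)) (by positivity)
      exact ⟨t, ht, hd⟩
    choose t ht hd using hseq
    have hlim : Tendsto (fun n => π (t n) x₀) atTop (𝓝 x) := by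
      rw [tendsto_iff_dist_tendsto_zero]
      refine squeeze_zero (fun _ => dist_nonneg) (fun n => ?_)
        tendsto_one_div_add_atTop_nhds_zero_nat
      rw [dist_comm]
      exact (hd n).le
    have hn0 : ∀ n : ℕ, (0 : ℝ) ≤ n := fun n => Nat.cast_nonneg n
    have hstep : ∀ n, π 1 (π (t n - 1) x₀) = π (t n) x₀ := by
      intro n
      rw [← hπadd 1 (t n - 1) zero_le_one (by linarith [ht n, hn0 n])]
      congr 1
      ring
    have hh : ∀ n, h (π (t n - 1) x₀) = σ (-1) (h (π (t n) x₀)) := by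
      intro n
      rw [← hstep n, hequiv 1 zero_le_one, ← hσadd]
      simp [hσ0]
    have hσ1 : Continuous (σ (-1)) := hσc.comp (continuous_const.prodMk continuous_id)
    have hlimY : Tendsto (fun n => h (π (t n - 1) x₀)) atTop (𝓝 (σ (-1) (h x))) := by
      simp only [hh]
      exact ((hσ1.comp hc).tendsto x).comp hlim
    have hK := hcp _ hlimY.isCompact_insert_range
    obtain ⟨y, -, φ, hφ, hy⟩ := hK.tendsto_subseq (x := fun n => π (t n - 1) x₀) (fun n =>
      subset_closure ⟨⟨t n - 1, by show (0 : ℝ) ≤ t n - 1; linarith [ht n, hn0 n], rfl⟩,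
        Set.mem_insert_of_mem _ ⟨n, rfl⟩⟩)
    refine ⟨y, ?_, ?_⟩
    · rw [memΩ]
      intro r hr
      refine mem_closure_of_tendsto hy ?_
      obtain ⟨N, hN⟩ := exists_nat_ge r
      filter_upwards [eventually_ge_atTop N] with n hn
      refine ⟨t (φ n) - 1, ?_, rfl⟩
      show r ≤ t (φ n) - 1
      have h1 : (N : ℝ) ≤ (φ n : ℝ) := by exact_mod_cast hn.trans (hφ.id_le n)
      linarith [ht (φ n)]
    · have h1 := ((hπt 1).tendsto y).comp hy
      have h2 := hlim.comp hφ.tendsto_atTop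
      refine tendsto_nhds_unique h1 (h2.congr fun n => ?_)
      exact (hstep (φ n)).symm
  intro x hx
  choose! b hbΩ hb using hback
  let z : ℕ → X := fun n => b^[n] x
  have hzΩ : ∀ n, z n ∈ Ω := by
    intro n
    induction n with
    | zero => exact hx
    | succ k ih =>
      show b^[k + 1] x ∈ Ω
      rw [Function.iterate_succ_apply']
      exact hbΩ _ ih
  have hz1 : ∀ n, π 1 (z (n + 1)) = z n := by
    intro n
    show π 1 (b^[n + 1] x) = z n
    rw [Function.iterate_succ_apply']
    exact hb _ (hzΩ n)
  have hcons : ∀ (s : ℝ) (n k : ℕ), 0 ≤ s + n →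
      π (s + (n + k : ℕ)) (z (n + k)) = π (s + n) (z n) := by
    intro s n k hs
    induction k with
    | zero => simp
    | succ k ih =>
      rw [← ih, ← hz1 (n + k), ← hπadd _ 1 (by push_cast; linarith [(Nat.cast_nonneg k : (0 : ℝ) ≤ k)]) zero_le_one]
      congr 1
      push_cast
      ring
  let γ : ℝ → X := fun s => π (s + ⌈-s⌉₊) (z ⌈-s⌉₊)
  have hceil : ∀ s : ℝ, 0 ≤ s + (⌈-s⌉₊ : ℝ) := fun s => by linarith [Nat.le_ceil (-s)]
  have hγ : ∀ (s : ℝ) (n : ℕ), 0 ≤ s + n → γ s = π (s + n) (z n) := by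
    intro s n hs
    have hle : ⌈-s⌉₊ ≤ n := Nat.ceil_le.2 (by linarith)
    obtain ⟨k, rfl⟩ := Nat.exists_eq_add_of_le hle
    exact (hcons s _ k (hceil s)).symm
  refine ⟨γ, ?_, ?_, ?_, ?_⟩
  · rw [continuous_iff_continuousAt]
    intro s
    obtain ⟨N, hN⟩ := exists_nat_gt (-s)
    have hcN : Continuous fun r : ℝ => π (r + N) (z N) :=
      hπc.comp ((continuous_id.add continuous_const).prodMk continuous_const)
    refine hcN.continuousAt.congr ?_
    filter_upwards [lt_mem_nhds (show -(N : ℝ) < s by linarith)] with r hr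
    exact (hγ r N (by linarith)).symm
  · rw [hγ 0 0 (by simp)]
    simp [hπ0, z]
  · intro t ht s
    rw [hγ s ⌈-s⌉₊ (hceil s), hγ (t + s) ⌈-s⌉₊ (by linarith [hceil s]),
      ← hπadd _ _ ht (hceil s), add_assoc]
  · intro s
    exact hinv _ (hceil s) _ (hzΩ _)
end

section
/- Let E be a Banach space, (Y,ℝ,σ) a dynamical system on a metric space Y, and U a linear cocycle over σ: for each t ≥ 0 and y ∈ Y, U(t,y) is a bounded linear operator on E, U(0,y) = Id, and U(t+s,y) = U(t,σ(s,y)) ∘ U(s,y) for all t,s ≥ 0. Assume U is hyperbolic: there is a map P : Y → L(E) with P(y)² = P(y) and, writing Q(y) := Id − P(y), P(σ(t,y)) ∘ U(t,y) = U(t,y) ∘ P(y) for all t ≥ 0, the operator U(t,y) maps the range of Q(y) bijectively onto the range of Q(σ(t,y)), and there exist constants N, ν > 0 with ‖U(t,y) ∘ P(y)‖ ≤ N e^{−νt} and ‖U(t,y)x‖ ≥ N^{−1} e^{νt} ‖x‖ for all x in the range of Q(y), for all t ≥ 0 and y ∈ Y. Let y₀ ∈ Y and let γ : ℝ → E be an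 entire trajectory of the cocycle through y₀, i.e. γ(t) = U(t−τ, σ(τ,y₀)) γ(τ) for all real t ≥ τ. If sup_{t∈ℝ} ‖γ(t)‖ < ∞, then γ(t) = 0 for every t ∈ ℝ. -/
/-- (Lemma on hyperbolic linear cocycles.) Every bounded entire
trajectory of a hyperbolic linear cocycle is identically zero. -/
theorem stmt_16 {E Y : Type*} [NormedAddCommGroup E] [NormedSpace ℝ E] [CompleteSpace E]
    [MetricSpace Y]
    (σ : ℝ → Y → Y)
    (hσc : Continuous fun p : ℝ × Y => σ p.1 p.2)
    (hσ0 : ∀ y, σ 0 y = y)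
    (hσadd : ∀ t s : ℝ, ∀ y, σ (t + s) y = σ t (σ s y))
    (U : ℝ → Y → E →L[ℝ] E)
    (hU0 : ∀ y, U 0 y = ContinuousLinearMap.id ℝ E)
    (hUcoc : ∀ t s : ℝ, 0 ≤ t → 0 ≤ s → ∀ y, U (t + s) y = (U t (σ s y)).comp (U s y))
    (P : Y → E →L[ℝ] E)
    (hPproj : ∀ y, (P y).comp (P y) = P y)
    (hPU : ∀ t : ℝ, 0 ≤ t → ∀ y, (P (σ t y)).comp (U t y) = (U t y).comp (P y))
    (hbij : ∀ t : ℝ, 0 ≤ t → ∀ y,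
      Set.BijOn (U t y) (Set.range ⇑(ContinuousLinearMap.id ℝ E - P y))
        (Set.range ⇑(ContinuousLinearMap.id ℝ E - P (σ t y))))
    (N ν : ℝ) (hN : 0 < N) (hν : 0 < ν)
    (hPdecay : ∀ t : ℝ, 0 ≤ t → ∀ y,
      ‖(U t y).comp (P y)‖ ≤ N * Real.exp (-ν * t))
    (hQgrow : ∀ t : ℝ, 0 ≤ t → ∀ y,
      ∀ x ∈ Set.range ⇑(ContinuousLinearMap.id ℝ E - P y),
        N⁻¹ * Real.exp (ν * t) * ‖x‖ ≤ ‖U t y x‖)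
    (y₀ : Y) (γ : ℝ → E)
    -- `γ` is an entire trajectory of the cocycle through `y₀`
    (hγ : ∀ t τ : ℝ, τ ≤ t → γ t = U (t - τ) (σ τ y₀) (γ τ))
    -- `γ` is bounded on `ℝ`
    (hbdd : ∃ C : ℝ, ∀ t : ℝ, ‖γ t‖ ≤ C) :
    ∀ t : ℝ, γ t = 0 := by
  obtain ⟨C, hC⟩ := hbdd
  have key : ∀ x : E, (∀ s : ℝ, 0 ≤ s → ‖x‖ ≤ N * Real.exp (-ν * s) * C) → x = 0 := by
    intro x hx
    have h1 : Filter.Tendsto (fun s : ℝ => -ν * s) Filter.atTop Filter.atBot :=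
      Filter.tendsto_id.const_mul_atTop_of_neg (by linarith)
    have h2 := ((Real.tendsto_exp_atBot.comp h1).const_mul N).mul_const C
    have h3 : ‖x‖ ≤ N * 0 * C := by
      refine ge_of_tendsto h2 ?_
      filter_upwards [Filter.eventually_ge_atTop (0 : ℝ)] with s hs
      exact hx s hs
    have h4 : ‖x‖ ≤ 0 := by simpa using h3
    exact norm_le_zero_iff.mp h4
  have hP : ∀ t : ℝ, P (σ t y₀) (γ t) = 0 := by
    intro t
    apply key
    intro s hs
    have e1 := hγ t (t - s) (by linarith)
    have e2 : t - (t - s) = s := by ring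
    rw [e2] at e1
    have e3 : σ s (σ (t - s) y₀) = σ t y₀ := by
      rw [← hσadd]; congr 1; ring
    have e4 := congrArg (fun f : E →L[ℝ] E => f (γ (t - s))) (hPU s hs (σ (t - s) y₀))
    rw [e3] at e4
    have e5 : P (σ t y₀) (γ t) =
        ((U s (σ (t - s) y₀)).comp (P (σ (t - s) y₀))) (γ (t - s)) := by
      rw [e1]; exact e4
    rw [e5]
    refine (ContinuousLinearMap.le_opNorm _ _).trans ?_
    exact mul_le_mul (hPdecay s hs _) (hC _) (norm_nonneg _) (by positivity)
  intro t
  apply key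
  intro s hs
  have g := hQgrow s hs (σ t y₀) (γ t) ⟨γ t, by simp [hP t]⟩
  have e1 := hγ (t + s) t (by linarith)
  rw [add_sub_cancel_left] at e1
  rw [← e1] at g
  have g2 := g.trans (hC _)
  have hexp : Real.exp (-ν * s) * Real.exp (ν * s) = 1 := by
    rw [← Real.exp_add]; simp
  calc ‖γ t‖ = (N * N⁻¹) * (Real.exp (-ν * s) * Real.exp (ν * s)) * ‖γ t‖ := by
        rw [hexp, mul_inv_cancel₀ hN.ne']; ring
    _ = N * Real.exp (-ν * s) * (N⁻¹ * Real.exp (ν * s) * ‖γ t‖) := by ring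
    _ ≤ N * Real.exp (-ν * s) * C := mul_le_mul_of_nonneg_left g2 (by positivity)
end

section
/- Let E be a Banach space and A : ℝ → L(E) a continuous function into the bounded linear operators on E, and let U : ℝ → L(E) be the Cauchy operator of the equation x' = A(t)x, i.e. U(0) = Id, each U(t) is invertible, and for every x ∈ E the map t ↦ U(t)x is differentiable with derivative A(t)(U(t)x). For s ∈ ℝ set P(s) := U(s) ∘ P₀ ∘ U(s)⁻¹ and Q(s) := Id − P(s), where P₀ ∈ L(E) is a projection (P₀² = P₀). Assume there exist constants N, ν > 0 such that for every s ∈ ℝ and every t ≥ 0: ‖U(t+s) ∘ U(s)⁻¹ ∘ P(s)‖ ≤ N e^{−νt}, and ‖U(t+s)(U(s)⁻¹ x)‖ ≥ N^{−1} e^{νt} ‖x‖ for every x in the range of Q(s). Then the equation x' = A(t)x admits an exponential dichotomy in the classical sense with projection P₀ and exponent ν: there exists a constant N' > 0 (depending only on N) such that ‖U(t) ∘ P₀ ∘ U(τ)⁻¹‖ ≤ N' e^{−ν(t−τ)} for all t ≥ τ and ‖U(t) ∘ (Id − P₀) ∘ U(τ)⁻¹‖ ≤ N' e^{ν(t−τ)}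 for all t ≤ τ. -/
/-- (Lemma: hyperbolicity in the cocycle sense implies classical
exponential dichotomy.) If the Cauchy operator `U` of `x' = A(t)x` satisfies, with
`P s := U s ∘ P₀ ∘ (U s)⁻¹` and `Q s := Id - P s`, the estimates
`‖U (t+s) ∘ (U s)⁻¹ ∘ P s‖ ≤ N e^{-νt}` and
`‖U (t+s) ((U s)⁻¹ x)‖ ≥ N⁻¹ e^{νt} ‖x‖` for `x` in the range of `Q s` (for all
`s ∈ ℝ`, `t ≥ 0`), then `x' = A(t)x` admits a classical exponential dichotomy with
projection `P₀` and exponent `ν`. -/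
theorem stmt_17 {E : Type*} [NormedAddCommGroup E] [NormedSpace ℝ E] [CompleteSpace E]
    (A : ℝ → E →L[ℝ] E) (hAc : Continuous A)
    (U : ℝ → E ≃L[ℝ] E)
    (hU0 : U 0 = ContinuousLinearEquiv.refl ℝ E)
    (hUderiv : ∀ (x : E) (t : ℝ), HasDerivAt (fun s : ℝ => U s x) (A t (U t x)) t)
    (P₀ : E →L[ℝ] E) (hP₀ : P₀.comp P₀ = P₀)
    (N ν : ℝ) (hN : 0 < N) (hν : 0 < ν)
    (hPdecay : ∀ s : ℝ, ∀ t : ℝ, 0 ≤ t →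
      ‖((U (t + s) : E →L[ℝ] E).comp ((U s).symm : E →L[ℝ] E)).comp
          ((U s : E →L[ℝ] E).comp (P₀.comp ((U s).symm : E →L[ℝ] E)))‖ ≤
        N * Real.exp (-ν * t))
    (hQgrow : ∀ s : ℝ, ∀ t : ℝ, 0 ≤ t →
      ∀ x ∈ Set.range ⇑(ContinuousLinearMap.id ℝ E -
          (U s : E →L[ℝ] E).comp (P₀.comp ((U s).symm : E →L[ℝ] E))),
        N⁻¹ * Real.exp (ν * t) * ‖x‖ ≤ ‖U (t + s) ((U s).symm x)‖) :
    ∃ N' > (0 : ℝ),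
      (∀ t τ : ℝ, τ ≤ t →
        ‖(U t : E →L[ℝ] E).comp (P₀.comp ((U τ).symm : E →L[ℝ] E))‖ ≤
          N' * Real.exp (-ν * (t - τ))) ∧
      (∀ t τ : ℝ, t ≤ τ →
        ‖(U t : E →L[ℝ] E).comp ((ContinuousLinearMap.id ℝ E - P₀).comp
            ((U τ).symm : E →L[ℝ] E))‖ ≤ N' * Real.exp (ν * (t - τ))) := by
  have e1 : ∀ t τ : ℝ, τ ≤ t →
      ‖(U t : E →L[ℝ] E).comp (P₀.comp ((U τ).symm : E →L[ℝ] E))‖ ≤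
        N * Real.exp (-ν * (t - τ)) := by
    intro t τ h
    have h1 := hPdecay τ (t - τ) (by linarith)
    rw [sub_add_cancel] at h1
    convert h1 using 2
    ext x
    simp
  refine ⟨N * (1 + N), by positivity, ?_, ?_⟩
  · intro t τ h
    refine (e1 t τ h).trans ?_
    have := Real.exp_pos (-ν * (t - τ))
    gcongr
    nlinarith
  · intro t τ h
    refine ContinuousLinearMap.opNorm_le_bound _ (by positivity) fun y => ?_
    have h2 := hQgrow t (τ - t) (by linarith)
      (U t ((U τ).symm y - P₀ ((U τ).symm y)))
      ⟨U t ((U τ).symm y - P₀ ((U τ).symm y)), by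
        have hp : ∀ z, P₀ (P₀ z) = P₀ z := fun z => by
          simpa using congrArg (fun f : E →L[ℝ] E => f z) hP₀
        simp [hp]⟩
    rw [sub_add_cancel, ContinuousLinearEquiv.symm_apply_apply] at h2
    have h3 : ‖U τ ((U τ).symm y - P₀ ((U τ).symm y))‖ ≤ (1 + N) * ‖y‖ := by
      have h4 := ContinuousLinearMap.le_of_opNorm_le _ (e1 τ τ le_rfl) y
      simp only [sub_self, mul_zero, Real.exp_zero, mul_one, ContinuousLinearMap.comp_apply,
        ContinuousLinearEquiv.coe_coe] at h4
      rw [map_sub, ContinuousLinearEquiv.apply_symm_apply]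
      refine (norm_sub_le _ _).trans ?_
      linarith
    have h5 := h2.trans h3
    have h6 : Real.exp (ν * (t - τ)) * Real.exp (ν * (τ - t)) = 1 := by
      rw [← Real.exp_add, ← Real.exp_zero]
      congr 1
      ring
    have h7 : ((U t : E →L[ℝ] E).comp ((ContinuousLinearMap.id ℝ E - P₀).comp
            ((U τ).symm : E →L[ℝ] E))) y = U t ((U τ).symm y - P₀ ((U τ).symm y)) := by
      simp
    rw [h7]
    set w := ‖U t ((U τ).symm y - P₀ ((U τ).symm y))‖
    calc w = (N * Real.exp (ν * (t - τ))) * (N⁻¹ * Real.exp (ν * (τ - t)) * w) := by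
          have : (N * Real.exp (ν * (t - τ))) * (N⁻¹ * Real.exp (ν * (τ - t)) * w)
            = (N * N⁻¹) * (Real.exp (ν * (t - τ)) * Real.exp (ν * (τ - t))) * w := by ring
          rw [this, h6, mul_inv_cancel₀ hN.ne']
          ring
      _ ≤ (N * Real.exp (ν * (t - τ))) * ((1 + N) * ‖y‖) := by gcongr
      _ = _ := by ring
end

section
/- Let E be a finite-dimensional normed space and A : ℝ → L(E) continuous. Let H(A) denote the closure of the set of translates {A^s : s ∈ ℝ}, where A^s(t) := A(t+s), in the space C(ℝ, L(E)) with the topology of uniform convergence on compact sets; note A ∈ H(A) and B^τ ∈ H(A) for every B ∈ H(A), τ ∈ ℝ. For each B ∈ H(A) let U_B : ℝ → L(E) be the Cauchy operator of x' = B(t)x: U_B(0) = Id, each U_B(t) is invertible, and for every x ∈ E the map t ↦ U_B(t)x is differentiable with derivative B(t)(U_B(t)x). Suppose x' = A(t)x admits an exponential dichotomy in the classical sense: there exist a projection P₀ ∈ L(E) (P₀² = P₀) and constants N, ν > 0 with ‖U_A(t) ∘ P₀ ∘ U_A(τ)⁻¹‖ ≤ N e^{−ν(t−τ)} for t ≥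 τ and ‖U_A(t) ∘ (Id − P₀) ∘ U_A(τ)⁻¹‖ ≤ N e^{ν(t−τ)} for t ≤ τ. Then there exists a continuous map P : H(A) → L(E) such that P(A) = P₀, P(B)² = P(B) for every B ∈ H(A), P(B^τ) = U_B(τ) ∘ P(B) ∘ U_B(τ)⁻¹ for every B ∈ H(A) and τ ∈ ℝ, and for every B ∈ H(A): ‖U_B(t) ∘ P(B) ∘ U_B(τ)⁻¹‖ ≤ N e^{−ν(t−τ)} for all t ≥ τ and ‖U_B(t) ∘ (Id − P(B)) ∘ U_B(τ)⁻¹‖ ≤ N e^{ν(t−τ)} for all t ≤ τ. -/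
/-- The `s`-shiftTranslate `A^s` of a continuous function `A : ℝ → Z`, `A^s (t) = A (t + s)`,
as an element of `C(ℝ, Z)` with the compact-open topology. -/
noncomputable def shiftTranslate {Z : Type*} [TopologicalSpace Z] (A : C(ℝ, Z)) (s : ℝ) :
    C(ℝ, Z) :=
  A.comp (Homeomorph.addRight s : C(ℝ, ℝ))

open Set Filter Topology

/-- Grönwall comparison of two linear equations. -/
theorem aux_gronwall {E : Type*} [NormedAddCommGroup E] [NormedSpace ℝ E]
    (C B : ℝ → E →L[ℝ] E) (y z : ℝ → E)
    (hy : ∀ s, HasDerivAt y (C s (y s)) s) (hz : ∀ s, HasDerivAt z (B s (z s)) s)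
    (h0 : y 0 = z 0) (t K ε M : ℝ)
    (hK : ∀ s ∈ uIcc 0 t, ‖C s‖ ≤ K) (hε : ∀ s ∈ uIcc 0 t, ‖C s - B s‖ ≤ ε)
    (hM : ∀ s ∈ uIcc 0 t, ‖z s‖ ≤ M) :
    ‖y t - z t‖ ≤ gronwallBound 0 (|t| * K) (|t| * (ε * M)) 1 := by
  have hsc : ∀ r : ℝ, HasDerivAt (fun r : ℝ => r * t) t r := fun r => by
    simpa using (hasDerivAt_id r).mul_const t
  have hder : ∀ r : ℝ, HasDerivAt (fun r : ℝ => y (r * t) - z (r * t))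
      (t • C (r * t) (y (r * t)) - t • B (r * t) (z (r * t))) r := fun r =>
    ((hy (r * t)).scomp r (hsc r)).sub ((hz (r * t)).scomp r (hsc r))
  have hmem : ∀ r ∈ Ico (0 : ℝ) 1, r * t ∈ uIcc 0 t := by
    intro r hr
    rw [mem_uIcc]
    rcases le_total 0 t with h | h
    · left; constructor <;> nlinarith [hr.1, hr.2]
    · right; constructor <;> nlinarith [hr.1, hr.2]
  have := norm_le_gronwallBound_of_norm_deriv_right_le (a := 0) (b := 1) (δ := 0)
    (K := |t| * K) (ε := |t| * (ε * M))
    (f := fun r : ℝ => y (r * t) - z (r * t))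
    (f' := fun r => t • C (r * t) (y (r * t)) - t • B (r * t) (z (r * t)))
    (fun r _ => (hder r).continuousAt.continuousWithinAt)
    (fun r _ => (hder r).hasDerivWithinAt) (by simp [h0]) ?_ 1 (by simp)
  · simpa using this
  · intro r hr
    have hm := hmem r hr
    have e : t • C (r * t) (y (r * t)) - t • B (r * t) (z (r * t)) =
        t • (C (r * t) (y (r * t) - z (r * t)) + (C (r * t) - B (r * t)) (z (r * t))) := by
      rw [← smul_sub]; congr 1
      simp
    rw [e, norm_smul, Real.norm_eq_abs, mul_assoc, ← mul_add]
    refine mul_le_mul_of_nonneg_left ?_ (abs_nonneg t)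
    refine (norm_add_le _ _).trans (add_le_add ?_ ?_)
    · exact (C (r * t)).le_of_opNorm_le (hK _ hm) _
    · refine ((C (r * t) - B (r * t)).le_of_opNorm_le (hε _ hm) _).trans ?_
      exact mul_le_mul_of_nonneg_left (hM _ hm) ((norm_nonneg _).trans (hε _ hm))

theorem aux_unique {E : Type*} [NormedAddCommGroup E] [NormedSpace ℝ E]
    (C : C(ℝ, E →L[ℝ] E)) (y z : ℝ → E)
    (hy : ∀ s, HasDerivAt y (C s (y s)) s) (hz : ∀ s, HasDerivAt z (C s (z s)) s)
    (h0 : y 0 = z 0) (t : ℝ) : y t = z t := by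
  obtain ⟨K, hK⟩ := (isCompact_uIcc (a := (0 : ℝ)) (b := t)).exists_bound_of_continuousOn
    C.continuous.continuousOn
  obtain ⟨M, hM⟩ := (isCompact_uIcc (a := (0 : ℝ)) (b := t)).exists_bound_of_continuousOn
    (f := z) (fun s _ => (hz s).continuousAt.continuousWithinAt)
  have := aux_gronwall C C y z hy hz h0 t K 0 M hK (by simp) hM
  rw [zero_mul, mul_zero, gronwallBound_ε0_δ0] at this
  exact sub_eq_zero.1 (norm_le_zero_iff.1 this)

/-- Continuous dependence of the Cauchy operators on the coefficient. -/
theorem aux_cont {E : Type*} [NormedAddCommGroup E] [NormedSpace ℝ E]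
    [FiniteDimensional ℝ E] (H : Set C(ℝ, E →L[ℝ] E))
    (U : C(ℝ, E →L[ℝ] E) → ℝ → (E ≃L[ℝ] E))
    (hU0 : ∀ B ∈ H, U B 0 = ContinuousLinearEquiv.refl ℝ E)
    (hUderiv : ∀ B ∈ H, ∀ (x : E) (t : ℝ),
      HasDerivAt (fun s : ℝ => U B s x) (B t (U B t x)) t) (t : ℝ) :
    Continuous (fun B : H => (U B t : E →L[ℝ] E)) := by
  rw [continuous_clm_apply]
  intro x
  rw [continuous_iff_continuousAt]
  rintro ⟨B, hB⟩
  obtain ⟨K, hK⟩ := (isCompact_uIcc (a := (0 : ℝ)) (b := t)).exists_bound_of_continuousOn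
    B.continuous.continuousOn
  obtain ⟨M, hM⟩ := (isCompact_uIcc (a := (0 : ℝ)) (b := t)).exists_bound_of_continuousOn
    (f := fun s => U B s x) (fun s _ => (hUderiv B hB x s).continuousAt.continuousWithinAt)
  have hg : Tendsto (fun ε : ℝ => gronwallBound 0 (|t| * (K + 1)) (|t| * (ε * M)) 1)
      (𝓝 0) (𝓝 0) := by
    have h1 : Continuous (fun ε : ℝ => gronwallBound 0 (|t| * (K + 1)) (|t| * (ε * M)) 1) :=
      (gronwallBound_continuous_ε 0 (|t| * (K + 1)) 1).comp (by fun_prop)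
    have h2 := h1.tendsto 0
    simpa [gronwallBound_ε0_δ0] using h2
  have hconv : TendstoUniformlyOn (fun (C : H) s => C.1 s) B (𝓝 ⟨B, hB⟩) (uIcc 0 t) :=
    ContinuousMap.tendsto_iff_forall_isCompact_tendstoUniformlyOn.1
      (continuous_subtype_val.tendsto (⟨B, hB⟩ : H)) _ isCompact_uIcc
  rw [Metric.tendstoUniformlyOn_iff] at hconv
  rw [ContinuousAt, Metric.tendsto_nhds]
  intro η hη
  have h3 : ∀ᶠ ε in 𝓝[>] (0 : ℝ),
      gronwallBound 0 (|t| * (K + 1)) (|t| * (ε * M)) 1 < η ∧ ε ≤ 1 ∧ 0 < ε := by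
    refine Filter.Eventually.and ?_ (Filter.Eventually.and ?_ self_mem_nhdsWithin)
    · exact nhdsWithin_le_nhds (hg.eventually_lt_const hη)
    · exact nhdsWithin_le_nhds (eventually_le_nhds one_pos)
  obtain ⟨ε, hε1, hε2, hε3⟩ := h3.exists
  filter_upwards [hconv ε hε3] with C hC
  have hd : ∀ s ∈ uIcc 0 t, ‖C.1 s - B s‖ ≤ ε := fun s hs => by
    have := (hC s hs).le
    rwa [dist_comm, dist_eq_norm] at this
  rw [dist_eq_norm]
  refine lt_of_le_of_lt ?_ hε1
  refine aux_gronwall C.1 B (fun s => U C.1 s x) (fun s => U B s x) (hUderiv _ C.2 x)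
    (hUderiv _ hB x) (by simp [hU0 _ C.2, hU0 _ hB]) t (K + 1) ε M ?_ hd hM
  intro s hs
  have h4 := norm_le_norm_add_norm_sub' (C.1 s) (B s)
  linarith [hK s hs, hd s hs]

theorem aux_cont_symm {E : Type*} [NormedAddCommGroup E] [NormedSpace ℝ E]
    [FiniteDimensional ℝ E] {X : Type*} [TopologicalSpace X] (V : X → (E ≃L[ℝ] E))
    (h : Continuous (fun B => (V B : E →L[ℝ] E))) :
    Continuous (fun B => ((V B).symm : E →L[ℝ] E)) := by
  have : CompleteSpace E := FiniteDimensional.complete ℝ E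
  rw [continuous_iff_continuousAt] at h ⊢
  intro B
  have h1 : ContinuousAt (ContinuousLinearMap.inverse : (E →L[ℝ] E) → (E →L[ℝ] E))
      (V B : E →L[ℝ] E) := (contDiffAt_map_inverse (𝕜 := ℝ) (n := 0) (V B)).continuousAt
  have h2 := ContinuousAt.comp (f := fun B => (V B : E →L[ℝ] E)) (x := B) h1 (h B)
  refine h2.congr (Eventually.of_forall fun C => ?_)
  simp

/-- Classical dichotomy. -/
def AuxDich {E : Type*} [NormedAddCommGroup E] [NormedSpace ℝ E] (N ν : ℝ)
    (V : ℝ → (E ≃L[ℝ] E)) (Q : E →L[ℝ] E) : Prop :=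
  Q.comp Q = Q ∧
  (∀ t τ : ℝ, τ ≤ t →
    ‖(V t : E →L[ℝ] E).comp (Q.comp ((V τ).symm : E →L[ℝ] E))‖ ≤ N * Real.exp (-ν * (t - τ))) ∧
  (∀ t τ : ℝ, t ≤ τ →
    ‖(V t : E →L[ℝ] E).comp ((ContinuousLinearMap.id ℝ E - Q).comp
      ((V τ).symm : E →L[ℝ] E))‖ ≤ N * Real.exp (ν * (t - τ)))

theorem aux_zero {E : Type*} [NormedAddCommGroup E] [NormedSpace ℝ E] (N ν : ℝ) (hν : 0 < ν)
    (R : E →L[ℝ] E)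
    (h : ∀ τ : ℝ, 0 ≤ τ → ‖R‖ ≤ (N * Real.exp (-ν * τ)) * (N * Real.exp (-ν * τ))) : R = 0 := by
  have h1 : Tendsto (fun τ : ℝ => N * Real.exp (-ν * τ)) atTop (𝓝 0) := by
    have : Tendsto (fun τ : ℝ => -ν * τ) atTop atBot :=
      tendsto_id.const_mul_atTop_of_neg (by linarith)
    simpa using (Real.tendsto_exp_atBot.comp this).const_mul N
  have h2 : Tendsto (fun τ : ℝ => (N * Real.exp (-ν * τ)) * (N * Real.exp (-ν * τ)))
      atTop (𝓝 0) := by simpa using h1.mul h1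
  have h3 : ‖R‖ ≤ 0 := ge_of_tendsto h2 ((eventually_ge_atTop 0).mono h)
  exact norm_le_zero_iff.1 h3

theorem AuxDich.unique {E : Type*} [NormedAddCommGroup E] [NormedSpace ℝ E] {N ν : ℝ}
    (hN : 0 < N) (hν : 0 < ν) {V : ℝ → (E ≃L[ℝ] E)} (hV : V 0 = ContinuousLinearEquiv.refl ℝ E)
    {Q R : E →L[ℝ] E} (hQ : AuxDich N ν V Q) (hR : AuxDich N ν V R) : Q = R := by
  obtain ⟨-, q1, q2⟩ := hQ
  obtain ⟨-, r1, r2⟩ := hR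
  have e1 : (ContinuousLinearMap.id ℝ E - R).comp Q = 0 := by
    refine aux_zero N ν hν _ fun τ hτ => ?_
    have a := r2 0 τ hτ
    have b := q1 τ 0 hτ
    have c : (ContinuousLinearMap.id ℝ E - R).comp Q =
      ((V 0 : E →L[ℝ] E).comp ((ContinuousLinearMap.id ℝ E - R).comp
        ((V τ).symm : E →L[ℝ] E))).comp
        ((V τ : E →L[ℝ] E).comp (Q.comp ((V 0).symm : E →L[ℝ] E))) := by
      ext x; simp [hV]
    rw [c]
    refine (ContinuousLinearMap.opNorm_comp_le _ _).trans ?_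
    rw [show ν * (0 - τ) = -ν * τ by ring] at a
    rw [sub_zero] at b
    exact mul_le_mul a b (norm_nonneg _) (by positivity)
  have e2 : R.comp (ContinuousLinearMap.id ℝ E - Q) = 0 := by
    refine aux_zero N ν hν _ fun τ hτ => ?_
    have a := r1 0 (-τ) (by linarith)
    have b := q2 (-τ) 0 (by linarith)
    have c : R.comp (ContinuousLinearMap.id ℝ E - Q) =
      ((V 0 : E →L[ℝ] E).comp (R.comp ((V (-τ)).symm : E →L[ℝ] E))).comp
        ((V (-τ) : E →L[ℝ] E).comp ((ContinuousLinearMap.id ℝ E - Q).comp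
          ((V 0).symm : E →L[ℝ] E))) := by
      ext x; simp [hV]
    rw [c]
    refine (ContinuousLinearMap.opNorm_comp_le _ _).trans ?_
    rw [show -ν * (0 - -τ) = -ν * τ by ring] at a
    rw [show ν * (-τ - 0) = -ν * τ by ring] at b
    exact mul_le_mul a b (norm_nonneg _) (by positivity)
  ext x
  have f1 := DFunLike.congr_fun e1 x
  have f2 := DFunLike.congr_fun e2 x
  simp [sub_eq_zero] at f1 f2
  rw [f1, f2]

theorem AuxDich.shift {E : Type*} [NormedAddCommGroup E] [NormedSpace ℝ E] {N ν : ℝ}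
    {V W : ℝ → (E ≃L[ℝ] E)} {s : ℝ} (hW : ∀ t x, W t x = V (t + s) ((V s).symm x))
    {Q : E →L[ℝ] E} (hQ : AuxDich N ν V Q) :
    AuxDich N ν W ((V s : E →L[ℝ] E).comp (Q.comp ((V s).symm : E →L[ℝ] E))) := by
  obtain ⟨q0, q1, q2⟩ := hQ
  have hWs : ∀ t x, (W t).symm x = V s ((V (t + s)).symm x) := by
    intro t x
    rw [ContinuousLinearEquiv.symm_apply_eq, hW]; simp
  refine ⟨?_, ?_, ?_⟩
  · ext x
    have := DFunLike.congr_fun q0 ((V s).symm x)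
    simpa using this
  · intro t τ h
    have := q1 (t + s) (τ + s) (by linarith)
    rw [show t + s - (τ + s) = t - τ by ring] at this
    convert this using 2
    ext x; simp [hW, hWs]
  · intro t τ h
    have := q2 (t + s) (τ + s) (by linarith)
    rw [show t + s - (τ + s) = t - τ by ring] at this
    convert this using 2
    ext x; simp [hW, hWs]

theorem aux_shift_mem {Z : Type*} [TopologicalSpace Z] (A B : C(ℝ, Z)) (τ : ℝ)
    (hB : B ∈ closure (Set.range (shiftTranslate A))) :
    shiftTranslate B τ ∈ closure (Set.range (shiftTranslate A)) := by
  have hc : Continuous (fun B : C(ℝ, Z) => shiftTranslate B τ) :=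
    ContinuousMap.continuous_precomp _
  refine map_mem_closure (f := fun B : C(ℝ, Z) => shiftTranslate B τ) hc hB ?_
  rintro _ ⟨s, rfl⟩
  refine ⟨τ + s, ?_⟩
  ext t
  simp [shiftTranslate, add_assoc]

/-- (Lemma: classical exponential dichotomy extends continuously to
the hull, in finite dimension.) If `x' = A(t)x` admits a classical exponential
dichotomy with projection `P₀` and constants `N, ν`, then there is a continuous map
`P` on the hull `H(A)` (the closure of the translates of `A` in the compact-open
topology) with `P A = P₀`, each `P B` a projection, the equivariance
`P (B^τ) = U_B(τ) ∘ P B ∘ U_B(τ)⁻¹`, and the same dichotomy estimates for every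
`B ∈ H(A)`. -/
theorem stmt_18 {E : Type*} [NormedAddCommGroup E] [NormedSpace ℝ E]
    [FiniteDimensional ℝ E]
    (A : C(ℝ, E →L[ℝ] E))
    (U : C(ℝ, E →L[ℝ] E) → ℝ → (E ≃L[ℝ] E))
    (hU0 : ∀ B ∈ closure (Set.range (shiftTranslate A)), U B 0 = ContinuousLinearEquiv.refl ℝ E)
    (hUderiv : ∀ B ∈ closure (Set.range (shiftTranslate A)), ∀ (x : E) (t : ℝ),
      HasDerivAt (fun s : ℝ => U B s x) (B t (U B t x)) t)
    (P₀ : E →L[ℝ] E) (hP₀ : P₀.comp P₀ = P₀)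
    (N ν : ℝ) (hN : 0 < N) (hν : 0 < ν)
    (hd1 : ∀ t τ : ℝ, τ ≤ t →
      ‖(U A t : E →L[ℝ] E).comp (P₀.comp ((U A τ).symm : E →L[ℝ] E))‖ ≤
        N * Real.exp (-ν * (t - τ)))
    (hd2 : ∀ t τ : ℝ, t ≤ τ →
      ‖(U A t : E →L[ℝ] E).comp ((ContinuousLinearMap.id ℝ E - P₀).comp
          ((U A τ).symm : E →L[ℝ] E))‖ ≤ N * Real.exp (ν * (t - τ))) :
    ∃ P : C(ℝ, E →L[ℝ] E) → (E →L[ℝ] E),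
      ContinuousOn P (closure (Set.range (shiftTranslate A))) ∧
      P A = P₀ ∧
      (∀ B ∈ closure (Set.range (shiftTranslate A)), (P B).comp (P B) = P B) ∧
      (∀ B ∈ closure (Set.range (shiftTranslate A)), ∀ τ : ℝ,
        P (shiftTranslate B τ) =
          ((U B τ : E →L[ℝ] E).comp ((P B).comp ((U B τ).symm : E →L[ℝ] E)))) ∧
      (∀ B ∈ closure (Set.range (shiftTranslate A)),
        (∀ t τ : ℝ, τ ≤ t →
          ‖(U B t : E →L[ℝ] E).comp ((P B).comp ((U B τ).symm : E →L[ℝ] E))‖ ≤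
            N * Real.exp (-ν * (t - τ))) ∧
        (∀ t τ : ℝ, t ≤ τ →
          ‖(U B t : E →L[ℝ] E).comp ((ContinuousLinearMap.id ℝ E - P B).comp
              ((U B τ).symm : E →L[ℝ] E))‖ ≤ N * Real.exp (ν * (t - τ)))) := by
  set H := closure (Set.range (shiftTranslate A)) with hH
  have hA0 : shiftTranslate A 0 = A := by ext t; simp [shiftTranslate]
  have hAH : A ∈ H := subset_closure ⟨0, hA0⟩
  have hAD : AuxDich N ν (U A) P₀ := ⟨hP₀, hd1, hd2⟩
  have hcoc : ∀ B ∈ H, ∀ s t x, U (shiftTranslate B s) t x = U B (t + s) ((U B s).symm x) := by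
    intro B hB s t x
    have hBs := aux_shift_mem A B s hB
    refine aux_unique (shiftTranslate B s) (fun t => U (shiftTranslate B s) t x)
      (fun t => U B (t + s) ((U B s).symm x)) (hUderiv _ hBs x) ?_ ?_ t
    · intro r
      exact (hUderiv B hB ((U B s).symm x) (r + s)).comp_add_const r s
    · simp [hU0 _ hBs]
  have hcont := aux_cont H U hU0 hUderiv
  have hconts : ∀ t, Continuous (fun B : H => ((U B t).symm : E →L[ℝ] E)) := fun t =>
    aux_cont_symm (fun B : H => U B t) (hcont t)
  have hbound : ∀ B ∈ H, ∀ Q, AuxDich N ν (U B) Q → Q ∈ Metric.closedBall (0 : E →L[ℝ] E) N := by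
    intro B hB Q hQ
    have h := hQ.2.1 0 0 le_rfl
    rw [hU0 B hB] at h
    rw [mem_closedBall_zero_iff]
    simpa using h
  have : CompactSpace (Metric.closedBall (0 : E →L[ℝ] E) N) :=
    isCompact_iff_compactSpace.1 (isCompact_closedBall _ _)
  let S : Set (H × Metric.closedBall (0 : E →L[ℝ] E) N) := {p | AuxDich N ν (U p.1) p.2}
  have hS : IsClosed S := by
    have c2 : Continuous (fun p : H × Metric.closedBall (0 : E →L[ℝ] E) N =>
      (p.2 : E →L[ℝ] E)) := by fun_prop
    have c3 : ∀ t, Continuous (fun p : H × Metric.closedBall (0 : E →L[ℝ] E) N =>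
      (U p.1 t : E →L[ℝ] E)) := fun t => (hcont t).comp continuous_fst
    have c4 : ∀ t, Continuous (fun p : H × Metric.closedBall (0 : E →L[ℝ] E) N =>
      ((U p.1 t).symm : E →L[ℝ] E)) := fun t => (hconts t).comp continuous_fst
    have hSe : S = {p | (p.2 : E →L[ℝ] E).comp (p.2 : E →L[ℝ] E) = p.2} ∩
        ((⋂ (t : ℝ) (τ : ℝ) (_ : τ ≤ t), {p |
          ‖(U p.1 t : E →L[ℝ] E).comp ((p.2 : E →L[ℝ] E).comp
            ((U p.1 τ).symm : E →L[ℝ] E))‖ ≤ N * Real.exp (-ν * (t - τ))}) ∩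
        (⋂ (t : ℝ) (τ : ℝ) (_ : t ≤ τ), {p |
          ‖(U p.1 t : E →L[ℝ] E).comp ((ContinuousLinearMap.id ℝ E - (p.2 : E →L[ℝ] E)).comp
            ((U p.1 τ).symm : E →L[ℝ] E))‖ ≤ N * Real.exp (ν * (t - τ))})) := by
      ext p
      simp only [S, AuxDich, mem_inter_iff, mem_iInter, mem_ofPred_eq]
    rw [hSe]
    refine IsClosed.inter ?_ (IsClosed.inter ?_ ?_)
    · exact isClosed_eq (c2.clm_comp c2) c2
    · refine isClosed_iInter fun t => isClosed_iInter fun τ => isClosed_iInter fun h => ?_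
      exact isClosed_le ((c3 t).clm_comp (c2.clm_comp (c4 τ))).norm continuous_const
    · refine isClosed_iInter fun t => isClosed_iInter fun τ => isClosed_iInter fun h => ?_
      exact isClosed_le
        ((c3 t).clm_comp ((continuous_const.sub c2).clm_comp (c4 τ))).norm continuous_const
  have hex : ∀ B ∈ H, ∃ Q, AuxDich N ν (U B) Q := by
    have h1 : IsClosed (Prod.fst '' S) := isClosedMap_fst_of_compactSpace _ hS
    have h2 : IsClosed (Subtype.val '' (Prod.fst '' S)) :=
      isClosed_closure.isClosedEmbedding_subtypeVal.isClosedMap _ h1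
    have h3 : Set.range (shiftTranslate A) ⊆ Subtype.val '' (Prod.fst '' S) := by
      rintro _ ⟨s, rfl⟩
      have hm : shiftTranslate A s ∈ H := subset_closure ⟨s, rfl⟩
      have hd := hAD.shift (hcoc A hAH s)
      exact ⟨⟨_, hm⟩, ⟨(⟨_, hm⟩, ⟨_, hbound _ hm _ hd⟩), hd, rfl⟩, rfl⟩
    intro B hB
    obtain ⟨_, ⟨p, hp, rfl⟩, rfl⟩ := closure_minimal h3 h2 hB
    exact ⟨_, hp⟩
  choose! P hP using hex
  have huniq : ∀ B ∈ H, ∀ Q, AuxDich N ν (U B) Q → P B = Q := fun B hB Q hQ =>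
    (hP B hB).unique hN hν (hU0 B hB) hQ
  refine ⟨P, ?_, huniq A hAH P₀ hAD, fun B hB => (hP B hB).1, ?_, fun B hB => (hP B hB).2⟩
  · rw [continuousOn_iff_continuous_domRestrict]
    let P' : H → Metric.closedBall (0 : E →L[ℝ] E) N := fun B => ⟨P B, hbound B B.2 _ (hP B B.2)⟩
    have hP' : Continuous P' := by
      rw [continuous_iff_isClosed]
      intro F hF
      have h1 : P' ⁻¹' F = Prod.fst '' (S ∩ Prod.snd ⁻¹' F) := by
        ext B
        constructor
        · intro h
          exact ⟨(B, P' B), ⟨hP B B.2, h⟩, rfl⟩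
        · rintro ⟨⟨B, Q⟩, ⟨h, h'⟩, rfl⟩
          have : P' B = Q := Subtype.ext (huniq B B.2 Q h)
          simpa [this] using h'
      rw [h1]
      exact isClosedMap_fst_of_compactSpace _ (hS.inter (hF.preimage continuous_snd))
    exact continuous_subtype_val.comp hP'
  · intro B hB τ
    exact huniq _ (aux_shift_mem A B τ hB) _ ((hP B hB).shift (hcoc B hB τ))
end

section
/- Let E be a finite-dimensional normed space and A : ℝ → L(E) a continuous Bohr almost periodic function: for every ε > 0 the set {τ ∈ ℝ : sup_{t∈ℝ} ‖A(t+τ) − A(t)‖ < ε} is relatively dense in ℝ. Let U : ℝ → L(E) be the Cauchy operator of x' = A(t)x (U(0) = Id, each U(t) invertible, and for every x ∈ E the map t ↦ U(t)x is differentiable with derivative A(t)(U(t)x)). Suppose the equation x' = A(t)x admits an exponential dichotomy: there exist a projection P₀ ∈ L(E) and constants N, ν > 0 with ‖U(t) ∘ P₀ ∘ U(τ)⁻¹‖ ≤ N e^{−ν(t−τ)} for t ≥ τ and ‖U(t) ∘ (Id − P₀) ∘ U(τ)⁻¹‖ ≤ N e^{ν(t−τ)} for t ≤ τ. Then the operator-valued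 function t ↦ P(t) := U(t) ∘ P₀ ∘ U(t)⁻¹ is Bohr almost periodic: for every ε > 0 the set {τ ∈ ℝ : sup_{t∈ℝ} ‖P(t+τ) − P(t)‖ < ε} is relatively dense in ℝ. -/
lemma aux_op_deriv {E : Type*} [NormedAddCommGroup E] [NormedSpace ℝ E]
    [FiniteDimensional ℝ E] (X : ℝ → E →L[ℝ] E) (X' : E →L[ℝ] E) (t : ℝ)
    (h : ∀ x, HasDerivAt (fun s => X s x) (X' x) t) : HasDerivAt X X' t := by
  classical
  let b := Module.finBasis ℝ E
  let c : Fin (Module.finrank ℝ E) → (E →L[ℝ] ℝ) := fun i => LinearMap.toContinuousLinearMap (b.coord i)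
  have key : ∀ L : E →L[ℝ] E,
      L = ∑ i, ContinuousLinearMap.smulRightL ℝ E E (c i) (L (b i)) := by
    intro L
    ext x
    have hx : L x = ∑ i, (b.repr x) i • L (b i) := by
      conv_lhs => rw [← b.sum_repr x]
      rw [map_sum]
      simp only [map_smul]
    simpa [c] using hx
  have h2 : HasDerivAt (fun s => ∑ i, ContinuousLinearMap.smulRightL ℝ E E (c i) (X s (b i)))
      (∑ i, ContinuousLinearMap.smulRightL ℝ E E (c i) (X' (b i))) t := by
    apply HasDerivAt.fun_sum
    intro i _
    exact (ContinuousLinearMap.smulRightL ℝ E E (c i)).hasFDerivAt.comp_hasDerivAt t (h (b i))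
  rw [← key X'] at h2
  convert! h2 using 1
  funext s
  exact key (X s)

lemma aux_inv_deriv {E : Type*} [NormedAddCommGroup E] [NormedSpace ℝ E]
    [FiniteDimensional ℝ E] (X : ℝ → E ≃L[ℝ] E) (A : E →L[ℝ] E) (t : ℝ)
    (h : HasDerivAt (fun s => (X s : E →L[ℝ] E)) (A * (X t : E →L[ℝ] E)) t) :
    HasDerivAt (fun s => ((X s).symm : E →L[ℝ] E)) (-(((X t).symm : E →L[ℝ] E) * A)) t := by
  have : CompleteSpace E := FiniteDimensional.complete ℝ E
  let u : (E →L[ℝ] E)ˣ := ContinuousLinearEquiv.toUnit (X t)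
  have h1 : HasFDerivAt Ring.inverse _ ((X t : E →L[ℝ] E)) := hasFDerivAt_ringInverse (𝕜 := ℝ) u
  have h2 := h1.comp_hasDerivAt t h
  convert! h2 using 1
  · funext s
    simp [ContinuousLinearMap.ringInverse_equiv]
  · have e1 : ((u⁻¹ : (E →L[ℝ] E)ˣ) : E →L[ℝ] E) = ((X t).symm : E →L[ℝ] E) := rfl
    ext x
    simp [e1]

lemma aux_bound {E : Type*} [NormedAddCommGroup E] [NormedSpace ℝ E]
    [FiniteDimensional ℝ E] (X Y : ℝ → E ≃L[ℝ] E) (A B : ℝ → E →L[ℝ] E)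
    (hX : ∀ x s, HasDerivAt (fun s => X s x) (A s (X s x)) s)
    (hY : ∀ x s, HasDerivAt (fun s => Y s x) (B s (Y s x)) s)
    (R S : E →L[ℝ] E) (N ν δ : ℝ) (hN : 0 < N) (hν : 0 < ν) (hδ : 0 < δ)
    (hAB : ∀ s, ‖B s - A s‖ ≤ δ)
    (h1 : ∀ s, 0 ≤ s → ‖(X 0 : E →L[ℝ] E) * (R * ((X s).symm : E →L[ℝ] E))‖ ≤ N * Real.exp (-ν * s))
    (h2 : ∀ s, 0 ≤ s → ‖(Y s : E →L[ℝ] E) * (S * ((Y 0).symm : E →L[ℝ] E))‖ ≤ N * Real.exp (-ν * s)) :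
    ‖((X 0 : E →L[ℝ] E) * (R * ((X 0).symm : E →L[ℝ] E))) *
      ((Y 0 : E →L[ℝ] E) * (S * ((Y 0).symm : E →L[ℝ] E)))‖ ≤ N ^ 2 * δ / (2 * ν) := by
  have dX : ∀ s, HasDerivAt (fun s => (X s : E →L[ℝ] E)) (A s * (X s : E →L[ℝ] E)) s :=
    fun s => aux_op_deriv _ _ _ (fun x => hX x s)
  have dY : ∀ s, HasDerivAt (fun s => (Y s : E →L[ℝ] E)) (B s * (Y s : E →L[ℝ] E)) s :=
    fun s => aux_op_deriv _ _ _ (fun x => hY x s)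
  have dXi := fun s => aux_inv_deriv X (A s) s (dX s)
  let F : ℝ → E →L[ℝ] E := fun s => ((X 0 : E →L[ℝ] E) * (R * ((X s).symm : E →L[ℝ] E))) *
      ((Y s : E →L[ℝ] E) * (S * ((Y 0).symm : E →L[ℝ] E)))
  let F' : ℝ → E →L[ℝ] E := fun s => ((X 0 : E →L[ℝ] E) * (R * ((X s).symm : E →L[ℝ] E))) *
      (B s - A s) * ((Y s : E →L[ℝ] E) * (S * ((Y 0).symm : E →L[ℝ] E)))
  have dF : ∀ s, HasDerivAt F (F' s) s := by
    intro s
    have := (((dXi s).const_mul R).const_mul (X 0 : E →L[ℝ] E)).mul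
      ((dY s).mul_const (S * ((Y 0).symm : E →L[ℝ] E)))
    convert! this using 1
    simp only [F']
    noncomm_ring
  have hexp : ∀ s, (N * Real.exp (-ν * s)) * (N * Real.exp (-ν * s))
      = N ^ 2 * Real.exp (-(2 * ν) * s) := by
    intro s
    have : Real.exp (-(2 * ν) * s) = Real.exp (-ν * s) * Real.exp (-ν * s) := by
      rw [← Real.exp_add]; ring_nf
    rw [this]; ring
  have bF : ∀ s, 0 ≤ s → ‖F s‖ ≤ N ^ 2 * Real.exp (-(2 * ν) * s) := by
    intro s hs
    rw [← hexp]
    exact (norm_mul_le _ _).trans (mul_le_mul (h1 s hs) (h2 s hs) (norm_nonneg _) (by positivity))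
  have bF' : ∀ s, 0 ≤ s → ‖F' s‖ ≤ N ^ 2 * δ * Real.exp (-(2 * ν) * s) := by
    intro s hs
    have e : N ^ 2 * δ * Real.exp (-(2 * ν) * s)
        = ((N * Real.exp (-ν * s)) * δ) * (N * Real.exp (-ν * s)) := by
      linear_combination (-δ) * hexp s
    rw [e]
    refine (norm_mul_le _ _).trans (mul_le_mul ((norm_mul_le _ _).trans ?_) (h2 s hs)
      (norm_nonneg _) (by positivity))
    exact mul_le_mul (h1 s hs) (hAB s) (norm_nonneg _) (by positivity)
  have key : ∀ b, 0 ≤ b → ‖F 0‖ ≤ N ^ 2 * δ / (2 * ν) + N ^ 2 * Real.exp (-(2 * ν) * b) := by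
    intro b hb
    have := image_norm_le_of_norm_deriv_right_le_deriv_boundary (a := 0) (b := b)
      (f := fun s => F s - F 0) (f' := F')
      (B := fun s => N ^ 2 * δ / (2 * ν) * (1 - Real.exp (-(2 * ν) * s)))
      (B' := fun s => N ^ 2 * δ * Real.exp (-(2 * ν) * s))
      (fun s _ => ((dF s).sub_const _).continuousAt.continuousWithinAt)
      (fun s _ => ((dF s).sub_const _).hasDerivWithinAt)
      (by simp)
      (by
        intro s
        have h := ((((hasDerivAt_id s).const_mul (-(2 * ν))).exp).const_sub 1).const_mul
          (N ^ 2 * δ / (2 * ν))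
        convert! h using 1
        simp only [id]
        field_simp)
      (fun s hs => bF' s hs.1) (Set.right_mem_Icc.2 hb)
    have h3 : N ^ 2 * δ / (2 * ν) * (1 - Real.exp (-(2 * ν) * b)) ≤ N ^ 2 * δ / (2 * ν) := by
      have : 0 ≤ N ^ 2 * δ / (2 * ν) * Real.exp (-(2 * ν) * b) := by positivity
      linarith
    have h4 := bF b hb
    have h5 : ‖F 0‖ ≤ ‖F b‖ + ‖F b - F 0‖ := by
      have := norm_sub_le (F b) (F b - F 0)
      simpa using this
    linarith
  have lim : Filter.Tendsto
      (fun b : ℝ => N ^ 2 * δ / (2 * ν) + N ^ 2 * Real.exp (-(2 * ν) * b)) Filter.atTop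
      (nhds (N ^ 2 * δ / (2 * ν) + N ^ 2 * 0)) := by
    refine Filter.Tendsto.const_add _ (Filter.Tendsto.const_mul _ ?_)
    refine Real.tendsto_exp_atBot.comp ?_
    exact Filter.tendsto_id.const_mul_atTop_of_neg (by linarith)
  have := ge_of_tendsto lim (Filter.eventually_atTop.2 ⟨0, key⟩)
  simpa [F] using this

/-- If `A : ℝ → L(E)` is Bohr almost periodic (`E` finite
dimensional) and the equation `x' = A(t)x` admits an exponential dichotomy with
projection `P₀`, then the projection-valued function `t ↦ U t ∘ P₀ ∘ (U t)⁻¹`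
is Bohr almost periodic. -/
theorem stmt_19 {E : Type*} [NormedAddCommGroup E] [NormedSpace ℝ E]
    [FiniteDimensional ℝ E]
    (A : ℝ → E →L[ℝ] E) (hAc : Continuous A)
    -- `A` is Bohr almost periodic
    (hAap : ∀ ε > (0 : ℝ), ∃ l > (0 : ℝ), ∀ a : ℝ, ∃ τ ∈ Set.Icc a (a + l),
      ∀ t : ℝ, ‖A (t + τ) - A t‖ < ε)
    (U : ℝ → E ≃L[ℝ] E)
    (hU0 : U 0 = ContinuousLinearEquiv.refl ℝ E)
    (hUderiv : ∀ (x : E) (t : ℝ), HasDerivAt (fun s : ℝ => U s x) (A t (U t x)) t)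
    (P₀ : E →L[ℝ] E) (hP₀ : P₀.comp P₀ = P₀)
    (N ν : ℝ) (hN : 0 < N) (hν : 0 < ν)
    -- exponential dichotomy in the classical sense
    (hd1 : ∀ t τ : ℝ, τ ≤ t →
      ‖(U t : E →L[ℝ] E).comp (P₀.comp ((U τ).symm : E →L[ℝ] E))‖ ≤
        N * Real.exp (-ν * (t - τ)))
    (hd2 : ∀ t τ : ℝ, t ≤ τ →
      ‖(U t : E →L[ℝ] E).comp ((ContinuousLinearMap.id ℝ E - P₀).comp
          ((U τ).symm : E →L[ℝ] E))‖ ≤ N * Real.exp (ν * (t - τ))) :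
    -- `t ↦ P(t) := U t ∘ P₀ ∘ (U t)⁻¹` is Bohr almost periodic
    ∀ ε > (0 : ℝ), ∃ l > (0 : ℝ), ∀ a : ℝ, ∃ τ ∈ Set.Icc a (a + l), ∀ t : ℝ,
      ‖(U (t + τ) : E →L[ℝ] E).comp (P₀.comp ((U (t + τ)).symm : E →L[ℝ] E)) -
        (U t : E →L[ℝ] E).comp (P₀.comp ((U t).symm : E →L[ℝ] E))‖ < ε := by
  intro ε hε
  obtain ⟨l, hl, H⟩ := hAap (ε * ν / (2 * N ^ 2)) (by positivity)
  refine ⟨l, hl, fun a => ?_⟩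
  obtain ⟨τ, hτ, hA⟩ := H a
  refine ⟨τ, hτ, fun t => ?_⟩
  have hδ : 0 < ε * ν / (2 * N ^ 2) := by positivity
  have shift : ∀ (c : ℝ) (x : E) (s : ℝ),
      HasDerivAt (fun s => U (c + s) x) (A (c + s) (U (c + s) x)) s := by
    intro c x s
    exact (hUderiv x (c + s)).comp_const_add c s
  have refl : ∀ (c : ℝ) (x : E) (s : ℝ),
      HasDerivAt (fun s => U (c - s) x) ((-A (c - s)) (U (c - s) x)) s := by
    intro c x s
    exact (hUderiv x (c - s)).comp_const_sub c s
  have b1 := aux_bound (fun s => U (t + s)) (fun s => U (t + τ + s)) (fun s => A (t + s))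
    (fun s => A (t + τ + s)) (shift t) (shift (t + τ)) (ContinuousLinearMap.id ℝ E - P₀) P₀ N ν _
    hN hν hδ
    (by
      intro s
      have := hA (t + s)
      rw [show t + s + τ = t + τ + s by ring] at this
      exact this.le)
    (by
      intro s hs
      have := hd2 t (t + s) (by linarith)
      rw [show ν * (t - (t + s)) = -ν * s by ring] at this
      simp only [add_zero]
      exact this)
    (by
      intro s hs
      have := hd1 (t + τ + s) (t + τ) (by linarith)
      rw [show -ν * (t + τ + s - (t + τ)) = -ν * s by ring] at this
      simp only [add_zero]
      exact this)
  have b2 := aux_bound (fun s => U (t - s)) (fun s => U (t + τ - s)) (fun s => -A (t - s))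
    (fun s => -A (t + τ - s)) (refl t) (refl (t + τ)) P₀ (ContinuousLinearMap.id ℝ E - P₀) N ν _
    hN hν hδ
    (by
      intro s
      have := hA (t - s)
      rw [show t - s + τ = t + τ - s by ring] at this
      rw [neg_sub_neg, norm_sub_rev]
      exact this.le)
    (by
      intro s hs
      have := hd1 t (t - s) (by linarith)
      rw [show -ν * (t - (t - s)) = -ν * s by ring] at this
      simp only [sub_zero]
      exact this)
    (by
      intro s hs
      have := hd2 (t + τ - s) (t + τ) (by linarith)
      rw [show ν * (t + τ - s - (t + τ)) = -ν * s by ring] at this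
      simp only [sub_zero]
      exact this)
  simp only [add_zero] at b1
  simp only [sub_zero] at b2
  have e1 : (U t : E →L[ℝ] E) * ((U t).symm : E →L[ℝ] E) = 1 := by ext x; simp
  have e2 : (U (t + τ) : E →L[ℝ] E) * ((U (t + τ)).symm : E →L[ℝ] E) = 1 := by ext x; simp
  have c1 : (U t : E →L[ℝ] E) * ((ContinuousLinearMap.id ℝ E - P₀) * ((U t).symm : E →L[ℝ] E))
      = 1 - (U t : E →L[ℝ] E) * (P₀ * ((U t).symm : E →L[ℝ] E)) := by
    rw [← e1]; ext x; simp
  have c2 : (U (t + τ) : E →L[ℝ] E) *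
      ((ContinuousLinearMap.id ℝ E - P₀) * ((U (t + τ)).symm : E →L[ℝ] E))
      = 1 - (U (t + τ) : E →L[ℝ] E) * (P₀ * ((U (t + τ)).symm : E →L[ℝ] E)) := by
    rw [← e2]; ext x; simp
  rw [c1] at b1
  rw [c2] at b2
  change ‖(U (t + τ) : E →L[ℝ] E) * (P₀ * ((U (t + τ)).symm : E →L[ℝ] E)) -
        (U t : E →L[ℝ] E) * (P₀ * ((U t).symm : E →L[ℝ] E))‖ < ε
  generalize (U (t + τ) : E →L[ℝ] E) * (P₀ * ((U (t + τ)).symm : E →L[ℝ] E)) = Q at b1 b2 ⊢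
  generalize (U t : E →L[ℝ] E) * (P₀ * ((U t).symm : E →L[ℝ] E)) = P at b1 b2 ⊢
  have e : Q - P = (1 - P) * Q - P * (1 - Q) := by noncomm_ring
  have v : N ^ 2 * (ε * ν / (2 * N ^ 2)) / (2 * ν) = ε / 4 := by
    field_simp; norm_num
  rw [v] at b1 b2
  rw [e]
  have := norm_sub_le ((1 - P) * Q) (P * (1 - Q))
  linarith
end
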